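/- arXiv:1705.07081 — 5 statements merged into one kernel-verified Lean document; each statement's English description precedes it below -/
import Mathlib

section
/- Assume the matching condition and conditions (1) and (2) hold, i.e., the classes are indexed so that α_i^(y) = α_i for all y ∈ Y and i ∈ [k], and Σ_{z∈Z_i^(y)} p_{Z|XY}(z|x,y) is the same for all y. Then: (a) p_{W|X}(i|x) := Σ_{z∈Z_i^(y)} p_{Z|XY}(z|x,y) is well defined (independent of y); (b) for each i ∈ [k], y ∈ Y and z ∈ Z_i^(y), the ratio p_{Z|XY}(z|x,y) / Σ_{z'∈Z_i^(y)} p_{Z|XY}(z'|x,y) is the same for every x ∈ X with α_i(x) > 0, defining a channel p_{Z|WY}(z|i,y) (set to 0 for z ∉ Z_i^(y)); (c) p_XYWZ(x,y,i,z) = p_XY(x,y)·p_{W|X}(i|x)·p_{Z|WY}(z|i,y); consequently, the Markov chains W−X−Y, Z−(W,Y)−X, and W−(Y,Z)−X all hold for the joint distribution p_XYWZ, and I(Z;W|Y) = H(W|Y). -/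
open scoped BigOperators
open scoped Classical

namespace SC

/-- `p` is a probability mass function on a finite type. -/
def IsPMF {α : Type*} [Fintype α] (p : α → ℝ) : Prop :=
  (∀ a, 0 ≤ p a) ∧ ∑ a, p a = 1

/-- Total variation distance between pmfs on a finite type. -/
noncomputable def tv {α : Type*} [Fintype α] (p q : α → ℝ) : ℝ :=
  (1 / 2) * ∑ a, |p a - q a|

/-- Shannon entropy (in bits) of the pushforward of the pmf `p` along `f`. -/
noncomputable def Hof {Ω β : Type*} [Fintype Ω] (p : Ω → ℝ) (f : Ω → β) : ℝ :=
  (∑ b ∈ Finset.univ.image f,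
      Real.negMulLog (∑ a ∈ Finset.univ.filter (fun a => f a = b), p a)) / Real.log 2

/-- Conditional Shannon entropy `H(A | B)` (bits) computed from the joint pmf `p`. -/
noncomputable def condEnt {Ω α β : Type*} [Fintype Ω] (p : Ω → ℝ)
    (A : Ω → α) (B : Ω → β) : ℝ :=
  Hof p (fun ω => (A ω, B ω)) - Hof p B

/-- Conditional mutual information `I(A ; C ∣ B)` (bits) from the joint pmf `p`. -/
noncomputable def cmi {Ω α β γ : Type*} [Fintype Ω] (p : Ω → ℝ)
    (A : Ω → α) (B : Ω → β) (C : Ω → γ) : ℝ :=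
  Hof p (fun ω => (A ω, B ω)) + Hof p (fun ω => (B ω, C ω)) - Hof p B
    - Hof p (fun ω => (A ω, B ω, C ω))

/-- The joint pmf `p_XYZ(x,y,z) = p_XY(x,y) · p_{Z|XY}(z|x,y)`. -/
noncomputable def jointXYZ {𝒳 𝒴 𝒵 : Type*} [Fintype 𝒳] [Fintype 𝒴] [Fintype 𝒵]
    (pXY : 𝒳 × 𝒴 → ℝ) (Q : 𝒳 → 𝒴 → 𝒵 → ℝ) : 𝒳 × 𝒴 × 𝒵 → ℝ :=
  fun w => pXY (w.1, w.2.1) * Q w.1 w.2.1 w.2.2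

/-- The `n`-fold product of `p_XYZ`. -/
noncomputable def prodXYZ {𝒳 𝒴 𝒵 : Type*} [Fintype 𝒳] [Fintype 𝒴] [Fintype 𝒵]
    (pXY : 𝒳 × 𝒴 → ℝ) (Q : 𝒳 → 𝒴 → 𝒵 → ℝ) (n : ℕ) :
    (Fin n → 𝒳) × (Fin n → 𝒴) × (Fin n → 𝒵) → ℝ :=
  fun w => ∏ i, jointXYZ pXY Q (w.1 i, w.2.1 i, w.2.2 i)

/-- The joint pmf of `(U, X, Y, Z)` obtained from `p_XYZ` and a conditional pmf
`p_{U|XYZ}` (with `U` ranging over `Fin k`). -/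
noncomputable def jointU {𝒳 𝒴 𝒵 : Type*} [Fintype 𝒳] [Fintype 𝒴] [Fintype 𝒵]
    (pXY : 𝒳 × 𝒴 → ℝ) (Q : 𝒳 → 𝒴 → 𝒵 → ℝ) {k : ℕ}
    (pU : 𝒳 × 𝒴 × 𝒵 → Fin k → ℝ) : Fin k × 𝒳 × 𝒴 × 𝒵 → ℝ :=
  fun w => jointXYZ pXY Q w.2 * pU w.2 w.1

/-- `Z^(y)`: outputs occurring with positive probability when Bob's input is `y`. -/
def Zyset {𝒳 𝒴 𝒵 : Type*} (Q : 𝒳 → 𝒴 → 𝒵 → ℝ) (y : 𝒴) : Set 𝒵 :=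
  {z | ∃ x, 0 < Q x y z}

/-- `z ∼_y z'`: the columns of `z` and `z'` are positive scalar multiples of each
other (both in `Z^(y)`). -/
def SimRel {𝒳 𝒴 𝒵 : Type*} (Q : 𝒳 → 𝒴 → 𝒵 → ℝ) (y : 𝒴) (z z' : 𝒵) : Prop :=
  z ∈ Zyset Q y ∧ z' ∈ Zyset Q y ∧ ∃ c : ℝ, 0 < c ∧ ∀ x, Q x y z = c * Q x y z'

/-- The `≡_y`-equivalence class of `z₀`, where `≡_y` is the equivalence relation
generated by `∼_y`. -/
def classOf {𝒳 𝒴 𝒵 : Type*} (Q : 𝒳 → 𝒴 → 𝒵 → ℝ) (y : 𝒴) (z₀ : 𝒵) : Set 𝒵 :=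
  {z | Relation.EqvGen (SimRel Q y) z z₀}

/-- The probability column vector `α` of (the class of) `z`: the normalized column. -/
noncomputable def alphaVec {𝒳 𝒴 𝒵 : Type*} [Fintype 𝒳]
    (Q : 𝒳 → 𝒴 → 𝒵 → ℝ) (y : 𝒴) (z : 𝒵) : 𝒳 → ℝ :=
  fun x => Q x y z / ∑ x', Q x' y z

/-- The set `{α_1^(y), …, α_{k(y)}^(y)}` of probability vectors of the classes at `y`. -/
def alphaSet {𝒳 𝒴 𝒵 : Type*} [Fintype 𝒳] (Q : 𝒳 → 𝒴 → 𝒵 → ℝ) (y : 𝒴) :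
    Set (𝒳 → ℝ) :=
  alphaVec Q y '' Zyset Q y

/-- `Σ_{z ∈ Z_i^(y)} p_{Z|XY}(z|x,y)` where `Z_i^(y)` is the class of `z₀`. -/
noncomputable def classSumOf {𝒳 𝒴 𝒵 : Type*} [Fintype 𝒵]
    (Q : 𝒳 → 𝒴 → 𝒵 → ℝ) (x : 𝒳) (y : 𝒴) (z₀ : 𝒵) : ℝ :=
  ∑ z ∈ Finset.univ.filter (fun z => z ∈ classOf Q y z₀), Q x y z

/-- `Σ_{z ∈ Z_i^(y)} p_{Z|XY}(z|x,y)` where `Z_i^(y)` is the class with vector `α`. -/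
noncomputable def classSumA {𝒳 𝒴 𝒵 : Type*} [Fintype 𝒳] [Fintype 𝒵]
    (Q : 𝒳 → 𝒴 → 𝒵 → ℝ) (x : 𝒳) (y : 𝒴) (α : 𝒳 → ℝ) : ℝ :=
  ∑ z ∈ Finset.univ.filter (fun z => z ∈ Zyset Q y ∧ alphaVec Q y z = α), Q x y z

variable {𝒳 𝒴 𝒵 : Type*} [Fintype 𝒳] [Fintype 𝒴] [Fintype 𝒵]
variable [Nonempty 𝒳] [Nonempty 𝒴] [Nonempty 𝒵]

section Entropy

variable {Ω α β γ δ : Type*} [Fintype Ω]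

/-- The probability, under `p`, of the fibre of `f` over `b`. -/
noncomputable def fiberMass (p : Ω → ℝ) (f : Ω → β) (b : β) : ℝ :=
  ∑ a, if f a = b then p a else 0

theorem fiberMass_pos {p : Ω → ℝ} (hp : ∀ a, 0 ≤ p a) (f : Ω → β) {ω : Ω} (hω : 0 < p ω) :
    0 < fiberMass p f (f ω) := by
  refine Finset.sum_pos' (fun a _ => ?_) ⟨ω, Finset.mem_univ _, by simpa using hω⟩
  split_ifs
  exacts [hp a, le_rfl]

theorem Hof_eq_sum_log (p : Ω → ℝ) (f : Ω → β) :
    Hof p f = (∑ ω, -(p ω * Real.log (fiberMass p f (f ω)))) / Real.log 2 := by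
  unfold Hof
  congr 1
  rw [← Finset.sum_fiberwise_of_maps_to (t := Finset.univ.image f) (g := f)
    (fun a _ => Finset.mem_image_of_mem f (Finset.mem_univ a))]
  refine Finset.sum_congr rfl fun b _ => ?_
  have hb : ∀ ω ∈ Finset.univ.filter (fun a => f a = b),
      -(p ω * Real.log (fiberMass p f (f ω))) = p ω * -Real.log (fiberMass p f b) := by
    intro ω hω
    rw [(Finset.mem_filter.1 hω).2, mul_neg]
  rw [Finset.sum_congr rfl hb, ← Finset.sum_mul, fiberMass, ← Finset.sum_filter,
    Real.negMulLog]
  ring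

theorem Hof_congr (p : Ω → ℝ) {f : Ω → β} {g : Ω → δ} (h : ∀ a b, f a = f b ↔ g a = g b) :
    Hof p f = Hof p g := by
  simp only [Hof_eq_sum_log, fiberMass, h]

/-- Conditional independence on the support of `p` makes the conditional mutual information
vanish. -/
theorem cmi_eq_zero {p : Ω → ℝ} (hp : ∀ a, 0 ≤ p a) (A : Ω → α) (B : Ω → β) (C : Ω → γ)
    (h : ∀ ω, 0 < p ω →
      fiberMass p (fun ω => (A ω, B ω, C ω)) (A ω, B ω, C ω) * fiberMass p B (B ω)
        = fiberMass p (fun ω => (A ω, B ω)) (A ω, B ω)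
          * fiberMass p (fun ω => (B ω, C ω)) (B ω, C ω)) :
    cmi p A B C = 0 := by
  simp only [cmi, Hof_eq_sum_log]
  rw [← add_div, ← sub_div, ← sub_div, ← Finset.sum_add_distrib, ← Finset.sum_sub_distrib,
    ← Finset.sum_sub_distrib, Finset.sum_eq_zero, zero_div]
  intro ω _
  rcases (hp ω).eq_or_lt with h0 | hω
  · simp [← h0]
  · have key := congrArg Real.log (h ω hω)
    rw [Real.log_mul (fiberMass_pos hp (fun ω => (A ω, B ω, C ω)) hω).ne'
        (fiberMass_pos hp B hω).ne',
      Real.log_mul (fiberMass_pos hp (fun ω => (A ω, B ω)) hω).ne'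
        (fiberMass_pos hp (fun ω => (B ω, C ω)) hω).ne'] at key
    linear_combination p ω * key

end Entropy

section Columns

variable {X Y Z : Type*} {Q : X → Y → Z → ℝ}

theorem eq_zero_of_notMem_Zyset (hQ : ∀ x y z, 0 ≤ Q x y z) {y : Y} {z : Z}
    (hz : z ∉ Zyset Q y) (x : X) : Q x y z = 0 :=
  le_antisymm (not_lt.1 fun h => hz ⟨x, h⟩) (hQ x y z)

variable [Fintype X]

theorem alphaVec_mul_sum (hQ : ∀ x y z, 0 ≤ Q x y z) (x : X) (y : Y) (z : Z) :
    alphaVec Q y z x * ∑ x', Q x' y z = Q x y z := by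
  by_cases h : ∑ x', Q x' y z = 0
  · rw [h, mul_zero]
    exact ((Finset.sum_eq_zero_iff_of_nonneg fun x' _ => hQ x' y z).1 h x
      (Finset.mem_univ x)).symm
  · exact div_mul_cancel₀ _ h

theorem sum_pos_of_mem_Zyset (hQ : ∀ x y z, 0 ≤ Q x y z) {y : Y} {z : Z}
    (hz : z ∈ Zyset Q y) : 0 < ∑ x, Q x y z := by
  obtain ⟨x, hx⟩ := hz
  exact Finset.sum_pos' (fun x' _ => hQ x' y z) ⟨x, Finset.mem_univ x, hx⟩

variable [Fintype Z]

/-- The total mass of the columns at `y` with normalized column `α`. -/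
noncomputable def classMass (Q : X → Y → Z → ℝ) (y : Y) (α : X → ℝ) : ℝ :=
  ∑ z ∈ Finset.univ.filter (fun z => z ∈ Zyset Q y ∧ alphaVec Q y z = α), ∑ x, Q x y z

theorem classSumA_eq_mul_classMass (hQ : ∀ x y z, 0 ≤ Q x y z) (x : X) (y : Y) (α : X → ℝ) :
    classSumA Q x y α = α x * classMass Q y α := by
  rw [classSumA, classMass, Finset.mul_sum]
  refine Finset.sum_congr rfl fun z hz => ?_
  rw [← (Finset.mem_filter.1 hz).2.2, alphaVec_mul_sum hQ]

theorem classMass_pos (hQ : ∀ x y z, 0 ≤ Q x y z) {y : Y} {z : Z} (hz : z ∈ Zyset Q y) :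
    0 < classMass Q y (alphaVec Q y z) :=
  Finset.sum_pos' (fun z' _ => Finset.sum_nonneg fun x _ => hQ x y z')
    ⟨z, by simp [hz], sum_pos_of_mem_Zyset hQ hz⟩

theorem div_classSumA (hQ : ∀ x y z, 0 ≤ Q x y z) {x : X} {y : Y} {z : Z}
    (hx : 0 < alphaVec Q y z x) :
    Q x y z / classSumA Q x y (alphaVec Q y z)
      = (∑ x', Q x' y z) / classMass Q y (alphaVec Q y z) := by
  rw [classSumA_eq_mul_classMass hQ]
  conv_lhs => rw [← alphaVec_mul_sum hQ x y z]
  exact mul_div_mul_left _ _ hx.ne'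

theorem sum_ite_alphaVec_eq (hQ : ∀ x y z, 0 ≤ Q x y z) (x : X) (y : Y) (α : X → ℝ) :
    (∑ z, if alphaVec Q y z = α then Q x y z else 0) = classSumA Q x y α := by
  rw [classSumA, Finset.sum_filter]
  refine Finset.sum_congr rfl fun z _ => ?_
  by_cases hz : z ∈ Zyset Q y
  · simp [hz]
  · simp [hz, eq_zero_of_notMem_Zyset hQ hz]

end Columns

section Markov

variable {X Y Z : Type*} [Fintype X] [Fintype Y] [Fintype Z] {pXY : X × Y → ℝ}
  {Q : X → Y → Z → ℝ}

theorem jointXYZ_nonneg (hp : ∀ w, 0 ≤ pXY w) (hQ : ∀ x y z, 0 ≤ Q x y z) (w : X × Y × Z) :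
    0 ≤ jointXYZ pXY Q w :=
  mul_nonneg (hp _) (hQ _ _ _)

theorem sum_ite_alphaVec_jointXYZ (hQ : ∀ x y z, 0 ≤ Q x y z) (x : X) (y : Y) (α : X → ℝ) :
    (∑ z, if alphaVec Q y z = α then jointXYZ pXY Q (x, y, z) else 0)
      = pXY (x, y) * classSumA Q x y α := by
  rw [← sum_ite_alphaVec_eq hQ, Finset.mul_sum]
  exact Finset.sum_congr rfl fun z _ => by simp [jointXYZ]

theorem cmi_alphaVec_input_eq_zero (hp : ∀ w, 0 ≤ pXY w) (hQ : ∀ x y, IsPMF (Q x y))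
    (h : ∀ (x : X) (α : X → ℝ) (y y' : Y), classSumA Q x y α = classSumA Q x y' α) :
    cmi (jointXYZ pXY Q) (fun w => alphaVec Q w.2.1 w.2.2) (fun w => w.1)
      (fun w => w.2.1) = 0 := by
  have hQ0 : ∀ x y z, 0 ≤ Q x y z := fun x y => (hQ x y).1
  have hZ : ∀ x y, ∑ z, jointXYZ pXY Q (x, y, z) = pXY (x, y) := fun x y => by
    simp only [jointXYZ, ← Finset.mul_sum, (hQ x y).2, mul_one]
  refine cmi_eq_zero (jointXYZ_nonneg hp hQ0) _ _ _ ?_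
  rintro ⟨x, y, z⟩ -
  generalize hα : alphaVec Q y z = α
  have e1 : fiberMass (jointXYZ pXY Q) (fun w => (alphaVec Q w.2.1 w.2.2, w.1, w.2.1))
      (α, x, y) = pXY (x, y) * classSumA Q x y α := by
    rw [← sum_ite_alphaVec_jointXYZ hQ0, fiberMass, Fintype.sum_prod_type,
      Fintype.sum_eq_single x (by intro a ha; simp [ha]), Fintype.sum_prod_type,
      Fintype.sum_eq_single y (by intro a ha; simp [ha])]
    simp
  have e2 : fiberMass (jointXYZ pXY Q) (fun w => w.1) x = ∑ y', pXY (x, y') := by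
    rw [fiberMass, Fintype.sum_prod_type,
      Fintype.sum_eq_single x (by intro a ha; simp [ha]), Fintype.sum_prod_type]
    simp [hZ]
  have e3 : fiberMass (jointXYZ pXY Q) (fun w => (alphaVec Q w.2.1 w.2.2, w.1)) (α, x)
      = (∑ y', pXY (x, y')) * classSumA Q x y α := by
    rw [fiberMass, Fintype.sum_prod_type,
      Fintype.sum_eq_single x (by intro a ha; simp [ha]), Fintype.sum_prod_type, Finset.sum_mul]
    refine Finset.sum_congr rfl fun y' _ => ?_
    rw [h x α y y', ← sum_ite_alphaVec_jointXYZ hQ0]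
    simp
  have e4 : fiberMass (jointXYZ pXY Q) (fun w => (w.1, w.2.1)) (x, y) = pXY (x, y) := by
    rw [fiberMass, Fintype.sum_prod_type,
      Fintype.sum_eq_single x (by intro a ha; simp [ha]), Fintype.sum_prod_type,
      Fintype.sum_eq_single y (by intro a ha; simp [ha])]
    simp [hZ]
  rw [e1, e2, e3, e4]
  ring

theorem cmi_output_alphaVec_eq_zero (hp : ∀ w, 0 ≤ pXY w) (hQ : ∀ x y z, 0 ≤ Q x y z) :
    cmi (jointXYZ pXY Q) (fun w => w.2.2)
      (fun w => (alphaVec Q w.2.1 w.2.2, w.2.1)) (fun w => w.1) = 0 := by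
  refine cmi_eq_zero (jointXYZ_nonneg hp hQ) _ _ _ ?_
  rintro ⟨x, y, z⟩ -
  have e1 : fiberMass (jointXYZ pXY Q)
      (fun w => (w.2.2, (alphaVec Q w.2.1 w.2.2, w.2.1), w.1)) (z, (alphaVec Q y z, y), x)
      = pXY (x, y) * Q x y z := by
    rw [fiberMass, Fintype.sum_eq_single (x, y, z)]
    · simp [jointXYZ]
    · rintro ⟨a, b, c⟩ hw
      refine if_neg fun he => hw ?_
      simp only [Prod.mk.injEq] at he ⊢
      exact ⟨he.2.2, he.2.1.2, he.1⟩
  have e2 : fiberMass (jointXYZ pXY Q) (fun w => (alphaVec Q w.2.1 w.2.2, w.2.1))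
      (alphaVec Q y z, y) = ∑ x', pXY (x', y) * classSumA Q x' y (alphaVec Q y z) := by
    rw [fiberMass, Fintype.sum_prod_type]
    refine Finset.sum_congr rfl fun x' _ => ?_
    rw [← sum_ite_alphaVec_jointXYZ hQ, Fintype.sum_prod_type,
      Fintype.sum_eq_single y (by intro a ha; simp [ha])]
    simp
  have e3 : fiberMass (jointXYZ pXY Q) (fun w => (w.2.2, alphaVec Q w.2.1 w.2.2, w.2.1))
      (z, alphaVec Q y z, y) = ∑ x', pXY (x', y) * Q x' y z := by
    rw [fiberMass, Fintype.sum_prod_type]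
    refine Finset.sum_congr rfl fun x' _ => ?_
    rw [Fintype.sum_prod_type, Fintype.sum_eq_single y (by intro a ha; simp [ha]),
      Fintype.sum_eq_single z (by intro a ha; simp [ha])]
    simp [jointXYZ]
  have e4 : fiberMass (jointXYZ pXY Q) (fun w => ((alphaVec Q w.2.1 w.2.2, w.2.1), w.1))
      ((alphaVec Q y z, y), x) = pXY (x, y) * classSumA Q x y (alphaVec Q y z) := by
    rw [← sum_ite_alphaVec_jointXYZ hQ, fiberMass, Fintype.sum_prod_type,
      Fintype.sum_eq_single x (by intro a ha; simp [ha]), Fintype.sum_prod_type,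
      Fintype.sum_eq_single y (by intro a ha; simp [ha])]
    simp
  rw [e1, e2, e3, e4, Finset.mul_sum, Finset.sum_mul]
  refine Finset.sum_congr rfl fun x' _ => ?_
  rw [classSumA_eq_mul_classMass hQ, classSumA_eq_mul_classMass hQ,
    ← alphaVec_mul_sum hQ x y z, ← alphaVec_mul_sum hQ x' y z]
  ring

end Markov

/-- Assume the matching condition (1) and the equal-column-sum
condition (2). Then: (a) `p_{W|X}(i|x) := Σ_{z∈Z_i^(y)} p_{Z|XY}(z|x,y)` is well
defined (independent of `y`); (b) for `z ∈ Z_i^(y)` the ratio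
`p_{Z|XY}(z|x,y) / Σ_{z'∈Z_i^(y)} p_{Z|XY}(z'|x,y)` is the same for every `x` with
`α_i(x) > 0`, defining a channel `p_{Z|WY}`; (c) `p_XYWZ` factorizes as
`p_XY · p_{W|X} · p_{Z|WY}`; consequently the Markov chains `W−X−Y`, `Z−(W,Y)−X`,
`W−(Y,Z)−X` all hold for `p_XYWZ`, and `I(Z;W|Y) = H(W|Y)`. -/
theorem W_channel_properties
    (pXY : 𝒳 × 𝒴 → ℝ) (Q : 𝒳 → 𝒴 → 𝒵 → ℝ)
    (hpXY : IsPMF pXY) (hQ : ∀ x y, IsPMF (Q x y))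
    (hfs : ∀ x y, 0 < pXY (x, y))
    (h1 : ∀ y y' : 𝒴, alphaSet Q y = alphaSet Q y')
    (h2 : ∀ (x : 𝒳) (α : 𝒳 → ℝ) (y y' : 𝒴), classSumA Q x y α = classSumA Q x y' α) :
    (∀ (x : 𝒳) (α : 𝒳 → ℝ) (y y' : 𝒴), classSumA Q x y α = classSumA Q x y' α) ∧
    (∀ (y : 𝒴) (z : 𝒵), z ∈ Zyset Q y → ∀ x x' : 𝒳,
        0 < alphaVec Q y z x → 0 < alphaVec Q y z x' →
        Q x y z / classSumA Q x y (alphaVec Q y z)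
          = Q x' y z / classSumA Q x' y (alphaVec Q y z)) ∧
    (∃ (pWX : 𝒳 → (𝒳 → ℝ) → ℝ) (pZWY : (𝒳 → ℝ) → 𝒴 → 𝒵 → ℝ),
      (∀ (x : 𝒳) (α : 𝒳 → ℝ) (y : 𝒴), pWX x α = classSumA Q x y α) ∧
      (∀ (y : 𝒴) (z : 𝒵), z ∈ Zyset Q y → ∀ x : 𝒳, 0 < alphaVec Q y z x →
        pZWY (alphaVec Q y z) y z = Q x y z / classSumA Q x y (alphaVec Q y z)) ∧
      (∀ (α : 𝒳 → ℝ) (y : 𝒴) (z : 𝒵), ¬(z ∈ Zyset Q y ∧ alphaVec Q y z = α) →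
        pZWY α y z = 0) ∧
      (∀ (x : 𝒳) (y : 𝒴) (α : 𝒳 → ℝ) (z : 𝒵),
        (if z ∈ Zyset Q y ∧ alphaVec Q y z = α then jointXYZ pXY Q (x, y, z) else 0)
          = pXY (x, y) * pWX x α * pZWY α y z)) ∧
    cmi (jointXYZ pXY Q) (fun w => alphaVec Q w.2.1 w.2.2) (fun w => w.1)
        (fun w => w.2.1) = 0 ∧
    cmi (jointXYZ pXY Q) (fun w => w.2.2)
        (fun w => (alphaVec Q w.2.1 w.2.2, w.2.1)) (fun w => w.1) = 0 ∧
    cmi (jointXYZ pXY Q) (fun w => alphaVec Q w.2.1 w.2.2)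
        (fun w => (w.2.1, w.2.2)) (fun w => w.1) = 0 ∧
    cmi (jointXYZ pXY Q) (fun w => w.2.2) (fun w => w.2.1)
        (fun w => alphaVec Q w.2.1 w.2.2)
      = condEnt (jointXYZ pXY Q) (fun w => alphaVec Q w.2.1 w.2.2)
          (fun w => w.2.1) := by
  have hQ0 : ∀ x y z, 0 ≤ Q x y z := fun x y => (hQ x y).1
  have hp0 := hpXY.1
  refine ⟨h2, ?_, ?_, cmi_alphaVec_input_eq_zero hp0 hQ h2,
    cmi_output_alphaVec_eq_zero hp0 hQ0, ?_, ?_⟩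
  · intro y z _ x x' hx hx'
    rw [div_classSumA hQ0 hx, div_classSumA hQ0 hx']
  · refine ⟨fun x α => classSumA Q x (Classical.arbitrary 𝒴) α,
      fun α y z => if z ∈ Zyset Q y ∧ alphaVec Q y z = α then
        (∑ x, Q x y z) / classMass Q y α else 0,
      fun x α y => h2 x α _ y, ?_, fun α y z hz => if_neg hz, ?_⟩
    · intro y z hz x hx
      rw [div_classSumA hQ0 hx]
      exact if_pos ⟨hz, rfl⟩
    · intro x y α z
      beta_reduce
      by_cases hz : z ∈ Zyset Q y ∧ alphaVec Q y z = α
      · rw [if_pos hz, if_pos hz, h2 x α _ y, classSumA_eq_mul_classMass hQ0]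
        obtain ⟨hz, rfl⟩ := hz
        have hT := (classMass_pos hQ0 hz).ne'
        rw [mul_assoc, mul_assoc, mul_div_cancel₀ _ hT, alphaVec_mul_sum hQ0]
        rfl
      · rw [if_neg hz, if_neg hz, mul_zero]
  · have e1 : Hof (jointXYZ pXY Q) (fun w => (alphaVec Q w.2.1 w.2.2, w.2.1, w.2.2))
        = Hof (jointXYZ pXY Q) (fun w => (w.2.1, w.2.2)) :=
      Hof_congr _ fun a b => by simp +contextual
    have e2 : Hof (jointXYZ pXY Q) (fun w => (alphaVec Q w.2.1 w.2.2, (w.2.1, w.2.2), w.1))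
        = Hof (jointXYZ pXY Q) (fun w => ((w.2.1, w.2.2), w.1)) :=
      Hof_congr _ fun a b => by simp +contextual
    rw [cmi, e1, e2]
    ring
  · have e1 : Hof (jointXYZ pXY Q) (fun w => (w.2.2, w.2.1, alphaVec Q w.2.1 w.2.2))
        = Hof (jointXYZ pXY Q) (fun w => (w.2.2, w.2.1)) :=
      Hof_congr _ fun a b => by simp +contextual
    have e2 : Hof (jointXYZ pXY Q) (fun w => (w.2.1, alphaVec Q w.2.1 w.2.2))
        = Hof (jointXYZ pXY Q) (fun w => (alphaVec Q w.2.1 w.2.2, w.2.1)) :=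
      Hof_congr _ fun a b => by simp [and_comm]
    rw [cmi, condEnt, e1, e2]
    ring

end SC
end

section
/- Suppose (p_XY, p_{Z|XY}) is computable with perfect security, witnessed by a finite set U and conditional pmf p_{U|XYZ} with joint p(u,x,y,z). Then for every u ∈ U with p_U(u) > 0 there is a single probability vector β_u on X such that for all (y,z) with p(u,y,z) > 0, the ≡_y-equivalence class Z_i^(y) containing z has α_i^(y) = β_u. In particular, when the classes are indexed consistently across y (α_i^(y) = α_i for all y), the random variable W defined by W = i whenever Z ∈ Z_i^(Y) is almost surely a deterministic function of U. -/
open scoped BigOperators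
open scoped Classical

namespace SC

/-- `p_{U|XYZ}` is a conditional pmf whose joint pmf `p_XYZ · p_{U|XYZ}` satisfies the
three Markov chains `U−X−Y`, `Z−(U,Y)−X` and `U−(Y,Z)−X`. -/
def SecureAux {𝒳 𝒴 𝒵 : Type*} [Fintype 𝒳] [Fintype 𝒴] [Fintype 𝒵]
    (pXY : 𝒳 × 𝒴 → ℝ) (Q : 𝒳 → 𝒴 → 𝒵 → ℝ) {k : ℕ}
    (pU : 𝒳 × 𝒴 × 𝒵 → Fin k → ℝ) : Prop :=
  (∀ w, IsPMF (pU w)) ∧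
  cmi (jointU pXY Q pU) (fun w => w.1) (fun w => w.2.1) (fun w => w.2.2.1) = 0 ∧
  cmi (jointU pXY Q pU) (fun w => w.2.2.2) (fun w => (w.1, w.2.2.1)) (fun w => w.2.1) = 0 ∧
  cmi (jointU pXY Q pU) (fun w => w.1) (fun w => (w.2.2.1, w.2.2.2)) (fun w => w.2.1) = 0

/-- `(p_XY, p_{Z|XY})` is computable with perfect security. -/
def PerfectlySecure {𝒳 𝒴 𝒵 : Type*} [Fintype 𝒳] [Fintype 𝒴] [Fintype 𝒵]
    (pXY : 𝒳 × 𝒴 → ℝ) (Q : 𝒳 → 𝒴 → 𝒵 → ℝ) : Prop :=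
  ∃ (k : ℕ) (pU : 𝒳 × 𝒴 × 𝒵 → Fin k → ℝ), SecureAux pXY Q pU

/-- The marginal pmf of `f` at `b`. -/
noncomputable def marginal {Ω β : Type*} [Fintype Ω] (p : Ω → ℝ) (f : Ω → β) (b : β) : ℝ :=
  ∑ ω, if f ω = b then p ω else 0

lemma Hof_eq_sum_marginal {Ω β : Type*} [Fintype Ω] [Fintype β] (p : Ω → ℝ) (f : Ω → β) :
    Hof p f = (∑ b, Real.negMulLog (marginal p f b)) / Real.log 2 := by
  unfold Hof marginal
  congr 1
  simp only [Finset.sum_filter]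
  refine Finset.sum_subset (Finset.subset_univ _) fun b _ hb => ?_
  have h0 : ∀ a, f a ≠ b := by simpa using hb
  simp [h0]

/-- A vanishing relative entropy between nonnegative functions of equal total mass forces
equality. -/
lemma eq_of_sum_mul_log_eq_zero {ι : Type*} [Fintype ι] (f q : ι → ℝ)
    (hf : ∀ i, 0 ≤ f i) (hq : ∀ i, 0 ≤ q i) (hac : ∀ i, q i = 0 → f i = 0)
    (hsum : ∑ i, f i = ∑ i, q i)
    (h : ∑ i, f i * (Real.log (f i) - Real.log (q i)) = 0) (i : ι) : f i = q i := by
  have term (i : ι) : q i * InformationTheory.klFun (f i / q i)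
      = f i * (Real.log (f i) - Real.log (q i)) + q i - f i := by
    unfold InformationTheory.klFun
    by_cases hqi : q i = 0
    · simp [hqi, hac i hqi]
    by_cases hfi : f i = 0
    · simp [hfi]
    rw [Real.log_div hfi hqi]
    field_simp
  have nonneg (i : ι) : 0 ≤ q i * InformationTheory.klFun (f i / q i) :=
    mul_nonneg (hq i) (InformationTheory.klFun_nonneg (div_nonneg (hf i) (hq i)))
  have zero : ∑ i, q i * InformationTheory.klFun (f i / q i) = 0 := by
    simp only [term, Finset.sum_add_distrib, Finset.sum_sub_distrib, h, hsum]
    ring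
  have hi := (Finset.sum_eq_zero_iff_of_nonneg fun i _ => nonneg i).1 zero i (Finset.mem_univ i)
  rcases mul_eq_zero.1 hi with h0 | h0
  · rw [h0, hac i h0]
  · rw [InformationTheory.klFun_eq_zero_iff (div_nonneg (hf i) (hq i))] at h0
    exact eq_of_div_eq_one h0

/-- Equality case of strong subadditivity for a nonnegative function of three variables. -/
lemma mul_marginals_eq_of_entropy_eq {α β γ : Type*} [Fintype α] [Fintype β] [Fintype γ]
    (P : α → β → γ → ℝ) (hP : ∀ a b c, 0 ≤ P a b c)
    (h : ∑ a, ∑ b, Real.negMulLog (∑ c, P a b c) + ∑ b, ∑ c, Real.negMulLog (∑ a, P a b c)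
      - ∑ b, Real.negMulLog (∑ a, ∑ c, P a b c)
      - ∑ a, ∑ b, ∑ c, Real.negMulLog (P a b c) = 0) (a : α) (b : β) (c : γ) :
    (∑ c', P a b c') * (∑ a', P a' b c) = (∑ a', ∑ c', P a' b c') * P a b c := by
  set L : α → β → ℝ := fun a b => ∑ c, P a b c with hL
  set R : β → γ → ℝ := fun b c => ∑ a, P a b c with hR
  set M : β → ℝ := fun b => ∑ a, ∑ c, P a b c with hM
  have L0 (a b) : 0 ≤ L a b := Finset.sum_nonneg fun c _ => hP a b c
  have R0 (b c) : 0 ≤ R b c := Finset.sum_nonneg fun a _ => hP a b c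
  have M0 (b) : 0 ≤ M b := Finset.sum_nonneg fun a _ => L0 a b
  have PL (a b c) : P a b c ≤ L a b :=
    Finset.single_le_sum (f := fun c => P a b c) (fun c _ => hP a b c) (Finset.mem_univ c)
  have PR (a b c) : P a b c ≤ R b c :=
    Finset.single_le_sum (f := fun a => P a b c) (fun a _ => hP a b c) (Finset.mem_univ a)
  have LM (a b) : L a b ≤ M b :=
    Finset.single_le_sum (f := fun a => L a b) (fun a _ => L0 a b) (Finset.mem_univ a)
  have MR (b) : M b = ∑ c, R b c := Finset.sum_comm
  set q : α × β × γ → ℝ := fun i => L i.1 i.2.1 * R i.2.1 i.2.2 / M i.2.1 with hq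
  have key := eq_of_sum_mul_log_eq_zero (fun i : α × β × γ => P i.1 i.2.1 i.2.2) q
    (fun i => hP _ _ _) (fun i => div_nonneg (mul_nonneg (L0 _ _) (R0 _ _)) (M0 _)) ?_ ?_ ?_
    (a, b, c)
  · simp only [hq] at key
    by_cases hb : M b = 0
    · have hLab : L a b = 0 := le_antisymm (hb ▸ LM a b) (L0 a b)
      change L a b * R b c = M b * P a b c
      rw [hb, hLab]
      simp
    · change L a b * R b c = M b * P a b c
      rw [key]
      field_simp
  · rintro ⟨a, b, c⟩ h0
    simp only [hq, div_eq_zero_iff, mul_eq_zero] at h0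
    refine le_antisymm ?_ (hP a b c)
    rcases h0 with (h0 | h0) | h0
    · exact h0 ▸ PL a b c
    · exact h0 ▸ PR a b c
    · exact h0 ▸ (PL a b c).trans (LM a b)
  · simp only [Fintype.sum_prod_type, hq]
    rw [Finset.sum_comm]
    conv_rhs => rw [Finset.sum_comm]
    refine Finset.sum_congr rfl fun b _ => ?_
    change M b = _
    simp only [← Finset.sum_div, ← Finset.mul_sum, ← Finset.sum_mul, ← MR]
    change M b = M b * M b / M b
    simp
  · have term (a b c) : P a b c * (Real.log (P a b c) - Real.log (L a b * R b c / M b))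
        = P a b c * Real.log (P a b c) - P a b c * Real.log (L a b) - P a b c * Real.log (R b c)
          + P a b c * Real.log (M b) := by
      rcases (hP a b c).eq_or_lt with h0 | h0
      · simp [← h0]
      have hl := h0.trans_le (PL a b c)
      have hr := h0.trans_le (PR a b c)
      have hm := hl.trans_le (LM a b)
      rw [Real.log_div (mul_pos hl hr).ne' hm.ne', Real.log_mul hl.ne' hr.ne']
      ring
    have eL : ∑ a, ∑ b, ∑ c, P a b c * Real.log (L a b)
        = - ∑ a, ∑ b, Real.negMulLog (L a b) := by
      simp only [Real.negMulLog, ← Finset.sum_mul, neg_mul, Finset.sum_neg_distrib, neg_neg, hL]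
    have eR : ∑ a, ∑ b, ∑ c, P a b c * Real.log (R b c)
        = - ∑ b, ∑ c, Real.negMulLog (R b c) := by
      rw [Finset.sum_comm]
      simp only [Real.negMulLog, neg_mul, Finset.sum_neg_distrib, neg_neg]
      refine Finset.sum_congr rfl fun b _ => ?_
      rw [Finset.sum_comm]
      simp only [← Finset.sum_mul, hR]
    have eM : ∑ a, ∑ b, ∑ c, P a b c * Real.log (M b) = - ∑ b, Real.negMulLog (M b) := by
      rw [Finset.sum_comm]
      simp only [Real.negMulLog, ← Finset.sum_mul, neg_mul, Finset.sum_neg_distrib, neg_neg, hM]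
    have eP : ∑ a, ∑ b, ∑ c, P a b c * Real.log (P a b c)
        = - ∑ a, ∑ b, ∑ c, Real.negMulLog (P a b c) := by
      simp only [Real.negMulLog, neg_mul, Finset.sum_neg_distrib, neg_neg]
    simp only [Fintype.sum_prod_type, hq, term, Finset.sum_add_distrib, Finset.sum_sub_distrib,
      eL, eR, eM, eP]
    linarith

/-- A vanishing conditional mutual information `I(A ; C ∣ B)` gives the conditional independence
of `A` and `C` given `B`. -/
lemma marginal_mul_marginal_of_cmi_eq_zero {Ω α β γ : Type*} [Fintype Ω] [Fintype α] [Fintype β]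
    [Fintype γ] (p : Ω → ℝ) (hp : ∀ ω, 0 ≤ p ω) (A : Ω → α) (B : Ω → β) (C : Ω → γ)
    (h : cmi p A B C = 0) (a : α) (b : β) (c : γ) :
    marginal p (fun ω => (A ω, B ω)) (a, b) * marginal p (fun ω => (B ω, C ω)) (b, c)
      = marginal p B b * marginal p (fun ω => (A ω, B ω, C ω)) (a, b, c) := by
  have eAB (a b) : marginal p (fun ω => (A ω, B ω)) (a, b)
      = ∑ c, marginal p (fun ω => (A ω, B ω, C ω)) (a, b, c) := by
    unfold marginal
    rw [Finset.sum_comm]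
    simp [ite_and]
  have eBC (b c) : marginal p (fun ω => (B ω, C ω)) (b, c)
      = ∑ a, marginal p (fun ω => (A ω, B ω, C ω)) (a, b, c) := by
    unfold marginal
    rw [Finset.sum_comm]
    simp [ite_and]
  have eB (b) : marginal p B b
      = ∑ a, ∑ c, marginal p (fun ω => (A ω, B ω, C ω)) (a, b, c) := by
    simp only [← eAB]
    unfold marginal
    rw [Finset.sum_comm]
    simp [ite_and]
  have hlog : Real.log 2 ≠ 0 := (Real.log_pos one_lt_two).ne'
  unfold cmi at h
  simp only [Hof_eq_sum_marginal, ← add_div, ← sub_div, div_eq_zero_iff, hlog, or_false,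
    Fintype.sum_prod_type, eAB, eBC, eB] at h
  rw [eAB, eBC, eB]
  exact mul_marginals_eq_of_entropy_eq
    (fun a b c => marginal p (fun ω => (A ω, B ω, C ω)) (a, b, c))
    (fun a b c => Finset.sum_nonneg fun ω _ => by split_ifs <;> simp [hp ω]) h a b c

lemma sum_ite_zero_right {ι : Type*} [Fintype ι] (P : Prop) [Decidable P] (f : ι → ℝ) :
    ∑ i, (if P then f i else 0) = if P then ∑ i, f i else 0 := by
  split_ifs <;> simp

/-- Given a message `u` and an output `z` of Bob's input `y`, the column of `z` is a positive
multiple of `x ↦ p(u | x)`. -/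
lemma exists_column_eq_mul {𝒳 𝒴 𝒵 : Type*} [Fintype 𝒳] [Fintype 𝒴] [Fintype 𝒵]
    (pXY : 𝒳 × 𝒴 → ℝ) (Q : 𝒳 → 𝒴 → 𝒵 → ℝ) (hQ : ∀ x y, IsPMF (Q x y))
    (hfs : ∀ x y, 0 < pXY (x, y)) (k : ℕ) (pU : 𝒳 × 𝒴 × 𝒵 → Fin k → ℝ)
    (hU : SecureAux pXY Q pU) (u : Fin k) (y : 𝒴) (z : 𝒵)
    (hpos : 0 < ∑ x, jointU pXY Q pU (u, (x, y, z))) :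
    ∃ c : ℝ, 0 < c ∧ ∀ x, Q x y z
      = c * ((∑ y', ∑ z', jointU pXY Q pU (u, (x, y', z'))) / ∑ y', pXY (x, y')) := by
  obtain ⟨hpU, h1, h2, h3⟩ := hU
  have J0 (w) : 0 ≤ jointU pXY Q pU w :=
    mul_nonneg (mul_nonneg (hfs _ _).le ((hQ _ _).1 _)) ((hpU _).1 _)
  have Jsum (x y z) : ∑ u', jointU pXY Q pU (u', (x, y, z)) = pXY (x, y) * Q x y z := by
    simp [jointU, jointXYZ, ← Finset.mul_sum, (hpU _).2]
  have Jsum' (x y) : ∑ u', ∑ z', jointU pXY Q pU (u', (x, y, z')) = pXY (x, y) := by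
    rw [Finset.sum_comm]
    simp [Jsum, ← Finset.mul_sum, (hQ x y).2]
  have Jsum'' (x) : ∑ u', ∑ y', ∑ z', jointU pXY Q pU (u', (x, y', z')) = ∑ y', pXY (x, y') := by
    rw [Finset.sum_comm]
    simp [Jsum']
  have k1 (x) := marginal_mul_marginal_of_cmi_eq_zero _ J0 _ _ _ h1 u x y
  have k2 (x) := marginal_mul_marginal_of_cmi_eq_zero _ J0 _ _ _ h2 z (u, y) x
  have k3 (x) := marginal_mul_marginal_of_cmi_eq_zero _ J0 _ _ _ h3 u (y, z) x
  simp only [marginal, Fintype.sum_prod_type, Prod.mk.injEq, ite_and] at k1 k2 k3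
  dsimp +instances only at k1 k2 k3
  simp only [Finset.sum_ite_eq', sum_ite_zero_right, Finset.mem_univ, if_true, Jsum, Jsum', Jsum'']
    at k1 k2 k3
  set N := ∑ x, jointU pXY Q pU (u, (x, y, z)) with hN
  set V := ∑ x, ∑ z', jointU pXY Q pU (u, (x, y, z')) with hV
  have hNV : N ≤ V := Finset.sum_le_sum fun x _ =>
    Finset.single_le_sum (f := fun z' => jointU pXY Q pU (u, (x, y, z'))) (fun _ _ => J0 _)
      (Finset.mem_univ z)
  set T := ∑ x, pXY (x, y) * Q x y z with hT
  have hNT : N ≤ T := Finset.sum_le_sum fun x _ => by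
    rw [← Jsum]
    exact Finset.single_le_sum (f := fun u' => jointU pXY Q pU (u', (x, y, z)))
      (fun _ _ => J0 _) (Finset.mem_univ u)
  have hV0 := hpos.trans_le hNV
  have hT0 := hpos.trans_le hNT
  refine ⟨T / V, div_pos hT0 hV0, fun x => ?_⟩
  have hS : 0 < ∑ y', pXY (x, y') := Finset.sum_pos (fun _ _ => hfs _ _) ⟨y, Finset.mem_univ y⟩
  have e3 := k3 x
  rw [Finset.sum_comm] at e3
  simp only [Jsum] at e3
  rw [div_mul_div_comm, eq_div_iff (mul_pos hV0 hS).ne']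
  refine mul_left_cancel₀ (mul_pos hpos (hfs x y)).ne' ?_
  linear_combination V * (∑ y', pXY (x, y')) * e3 - T * (∑ y', pXY (x, y')) * k2 x - T * N * k1 x

/-- A column proportional to `r` normalizes to the normalization of `r`. -/
lemma alphaVec_eq_of_column_eq_mul {𝒳 𝒴 𝒵 : Type*} [Fintype 𝒳] (Q : 𝒳 → 𝒴 → 𝒵 → ℝ) (y : 𝒴)
    (z : 𝒵) (r : 𝒳 → ℝ) (c : ℝ) (hc : 0 < c) (h : ∀ x, Q x y z = c * r x) :
    alphaVec Q y z = fun x => r x / ∑ x', r x' := by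
  funext x
  simp only [alphaVec, h, ← Finset.mul_sum]
  exact mul_div_mul_left _ _ hc.ne'

variable {𝒳 𝒴 𝒵 : Type*} [Fintype 𝒳] [Fintype 𝒴] [Fintype 𝒵]
variable [Nonempty 𝒳] [Nonempty 𝒴] [Nonempty 𝒵]

/-- Under full support and perfect security (witnessed by
`p_{U|XYZ}` with joint `p(u,x,y,z)`): every message `u` with `p_U(u) > 0` determines a
single probability vector `β_u` such that whenever `p(u,y,z) > 0`, the class of `z` at
`y` has probability vector `β_u`. In particular `W` (the class-index, identified with
its probability vector `alphaVec Q y z`) is a.s. a deterministic function of `U`. -/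
theorem message_determines_class
    (pXY : 𝒳 × 𝒴 → ℝ) (Q : 𝒳 → 𝒴 → 𝒵 → ℝ)
    (hpXY : IsPMF pXY) (hQ : ∀ x y, IsPMF (Q x y))
    (hfs : ∀ x y, 0 < pXY (x, y))
    (k : ℕ) (pU : 𝒳 × 𝒴 × 𝒵 → Fin k → ℝ) (hU : SecureAux pXY Q pU) :
    (∀ u : Fin k,
      0 < (∑ w : 𝒳 × 𝒴 × 𝒵, jointU pXY Q pU (u, w)) →
      ∃ β : 𝒳 → ℝ, (∀ x, 0 ≤ β x) ∧ (∑ x, β x = 1) ∧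
        ∀ (y : 𝒴) (z : 𝒵), 0 < (∑ x, jointU pXY Q pU (u, (x, y, z))) →
          alphaVec Q y z = β) ∧
    (∃ g : Fin k → (𝒳 → ℝ), ∀ (u : Fin k) (x : 𝒳) (y : 𝒴) (z : 𝒵),
      0 < jointU pXY Q pU (u, (x, y, z)) → alphaVec Q y z = g u) := by
  have J0 (w) : 0 ≤ jointU pXY Q pU w :=
    mul_nonneg (mul_nonneg (hfs _ _).le ((hQ _ _).1 _)) ((hU.1 _).1 _)
  set r : Fin k → 𝒳 → ℝ := fun u x =>
    (∑ y', ∑ z', jointU pXY Q pU (u, (x, y', z'))) / ∑ y', pXY (x, y') with hr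
  have r0 (u x) : 0 ≤ r u x :=
    div_nonneg (Finset.sum_nonneg fun _ _ => Finset.sum_nonneg fun _ _ => J0 _)
      (Finset.sum_nonneg fun _ _ => (hfs _ _).le)
  have key (u y z) (h : 0 < ∑ x, jointU pXY Q pU (u, (x, y, z))) :
      alphaVec Q y z = fun x => r u x / ∑ x', r u x' := by
    obtain ⟨c, hc, hcol⟩ := exists_column_eq_mul pXY Q hQ hfs k pU hU u y z h
    exact alphaVec_eq_of_column_eq_mul Q y z (r u) c hc hcol
  refine ⟨fun u hu => ⟨fun x => r u x / ∑ x', r u x', fun x =>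
    div_nonneg (r0 u x) (Finset.sum_nonneg fun x _ => r0 u x), ?_, key u⟩,
    fun u x => r u x / ∑ x', r u x', fun u x y z h => key u y z ?_⟩
  · rw [← Finset.sum_div]
    refine div_self fun h0 => hu.ne' ?_
    rw [Finset.sum_eq_zero_iff_of_nonneg fun x _ => r0 u x] at h0
    rw [Fintype.sum_prod_type]
    refine Finset.sum_eq_zero fun x hx => ?_
    have hp : 0 < ∑ y', pXY (x, y') := Finset.sum_pos (fun _ _ => hfs _ _) Finset.univ_nonempty
    rw [Fintype.sum_prod_type]
    exact (div_eq_zero_iff.1 (h0 x hx)).resolve_right hp.ne'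
  · exact h.trans_le (Finset.single_le_sum (f := fun x => jointU pXY Q pU (u, (x, y, z)))
      (fun _ _ => J0 _) (Finset.mem_univ x))

end SC
end

section
/- Let p̄ be a pmf on X×Y×Z×F×M, let p̂ be a pmf on X×Y×Z×F×M whose F-marginal is uniform (p̂(f) = 1/|F| for all f ∈ F), and let p be a pmf on X×Y×Z. Let ε, δ ≥ 0 satisfy ||p̄(x,y,z,f) − p^U(f)·p(x,y,z)||_1 ≤ ε (total variation on X×Y×Z×F after marginalizing out M) and ||p̂(x,y,z,f,m) − p̄(x,y,z,f,m)||_1 ≤ δ. Then there exists f ∈ F with p̄(f) > 0 such that ||p̄(x,y,z | f) − p(x,y,z)||_1 ≤ 3ε + δ and ||p̂(x,y,z,m | f) − p̄(x,y,z,m | f)||_1 ≤ 3ε + δ. -/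
open scoped BigOperators
open scoped Classical

namespace SC

theorem tv_nonneg {α : Type*} [Fintype α] (p q : α → ℝ) : 0 ≤ tv p q :=
  mul_nonneg (by norm_num) (Finset.sum_nonneg fun _ _ => abs_nonneg _)

/-- Normalizing `r` and `s` by `R` and `S` increases their total variation distance, once rescaled
by `R`, by at most half of `|R - S|`. -/
theorem mul_tv_div_le {α : Type*} [Fintype α] {r s : α → ℝ} {R S : ℝ}
    (hs : ∀ a, 0 ≤ s a) (hsum : ∑ a, s a = S) (hS : 0 < S) (hR : 0 < R) :
    R * tv (fun a => s a / S) (fun a => r a / R) ≤ tv r s + |R - S| / 2 := by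
  have hpt (a : α) : R * |s a / S - r a / R| ≤ |r a - s a| + s a * (|R - S| / S) := by
    have h : R * (s a / S - r a / R) = -(r a - s a) + s a * ((R - S) / S) := by
      field_simp
      ring
    calc R * |s a / S - r a / R| = |R * (s a / S - r a / R)| := by rw [abs_mul, abs_of_pos hR]
      _ ≤ |r a - s a| + s a * (|R - S| / S) := by
          rw [h]
          refine (abs_add_le _ _).trans_eq ?_
          rw [abs_neg, abs_mul, abs_div, abs_of_pos hS, abs_of_nonneg (hs a)]
  have h := Finset.sum_le_sum fun a (_ : a ∈ Finset.univ) => hpt a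
  rw [← Finset.mul_sum, Finset.sum_add_distrib, ← Finset.sum_mul, hsum,
    mul_div_cancel₀ _ hS.ne'] at h
  unfold tv
  linarith

theorem tv_comm {α : Type*} [Fintype α] (p q : α → ℝ) : tv p q = tv q p := by
  simp only [tv, abs_sub_comm]

theorem abs_sum_sub_sum_le_two_mul_tv {α : Type*} [Fintype α] (p q : α → ℝ) :
    |∑ a, p a - ∑ a, q a| ≤ 2 * tv p q := by
  rw [← Finset.sum_sub_distrib, tv]
  linarith [Finset.abs_sum_le_sum_abs (fun a => p a - q a) Finset.univ]

theorem exists_pos_and_le_of_sum_mul_le {ι : Type*} [Fintype ι] {q T : ι → ℝ} {c : ℝ}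
    (hq : IsPMF q) (h : ∑ i, q i * T i ≤ c) : ∃ i, 0 < q i ∧ T i ≤ c := by
  by_contra! hc
  have hle (i : ι) : q i * c ≤ q i * T i := by
    rcases (hq.1 i).eq_or_lt with h0 | h0
    · simp [← h0]
    · exact mul_le_mul_of_nonneg_left (hc i h0).le h0.le
  obtain ⟨i, -, hi⟩ := (Finset.sum_pos_iff_of_nonneg fun i _ => hq.1 i).1 (hq.2 ▸ one_pos)
  have hlt : ∑ i, q i * c < ∑ i, q i * T i :=
    Finset.sum_lt_sum (fun i _ => hle i)
      ⟨i, Finset.mem_univ i, mul_lt_mul_of_pos_left (hc i hi) hi⟩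
  rw [← Finset.sum_mul, hq.2, one_mul] at hlt
  linarith

/-- Some value of the shared randomness is good for both conditional distributions: `A` is the
joint mass of the index with the first variable, `B` and `C` are two joint masses of the index with the second
one; the index has mass `q` under `A` and the constant mass `u` under `C`. -/
theorem exists_pos_and_tv_div_le {ι α β : Type*} [Fintype ι] [Fintype α] [Fintype β]
    {q : ι → ℝ} {A : ι → α → ℝ} {B C : ι → β → ℝ} {p : α → ℝ} {u ε δ : ℝ}
    (hu : 0 < u) (hq : IsPMF q) (hp : IsPMF p) (hC : ∀ i b, 0 ≤ C i b)
    (hA : ∀ i, ∑ a, A i a = q i) (hCu : ∀ i, ∑ b, C i b = u)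
    (h1 : ∑ i, tv (A i) (fun a => u * p a) ≤ ε) (h2 : ∑ i, tv (C i) (B i) ≤ δ) :
    ∃ i, 0 < q i ∧ tv (fun a => A i a / q i) p ≤ 3 * ε + δ ∧
      tv (fun b => C i b / u) (fun b => B i b / q i) ≤ 3 * ε + δ := by
  have hps : ∑ a, u * p a = u := by rw [← Finset.mul_sum, hp.2, mul_one]
  obtain ⟨i, hi, hT⟩ := exists_pos_and_le_of_sum_mul_le (c := 3 * ε + δ)
    (T := fun i => tv (fun a => A i a / q i) p +
      tv (fun b => C i b / u) (fun b => B i b / q i)) hq <| by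
    have hpt (i : ι) : q i * (tv (fun a => A i a / q i) p +
        tv (fun b => C i b / u) (fun b => B i b / q i)) ≤
        3 * tv (A i) (fun a => u * p a) + tv (C i) (B i) := by
      rcases (hq.1 i).eq_or_lt with h0 | h0
      · rw [← h0, zero_mul]
        linarith [tv_nonneg (A i) (fun a => u * p a), tv_nonneg (C i) (B i)]
      · have hd := abs_sum_sub_sum_le_two_mul_tv (A i) (fun a => u * p a)
        rw [hA, hps] at hd
        have hT1 := mul_tv_div_le (r := A i) (fun a => mul_nonneg hu.le (hp.1 a)) hps hu h0
        simp only [mul_div_cancel_left₀ _ hu.ne'] at hT1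
        have hT2 := mul_tv_div_le (r := B i) (hC i) (hCu i) hu h0
        rw [tv_comm] at hT1
        rw [tv_comm (B i)] at hT2
        linarith
    refine (Finset.sum_le_sum fun i _ => hpt i).trans ?_
    rw [Finset.sum_add_distrib, ← Finset.mul_sum]
    linarith
  have := tv_nonneg (fun a => A i a / q i) p
  have := tv_nonneg (fun b => C i b / u) (fun b => B i b / q i)
  exact ⟨i, hi, by linarith, by linarith⟩

theorem sum_sum_shared {X Y Z F M : Type*} [Fintype X] [Fintype Y] [Fintype Z] [Fintype F]
    [Fintype M] (g : X × Y × Z × F × M → ℝ) :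
    ∑ f, ∑ w : X × Y × Z × M, g (w.1, w.2.1, w.2.2.1, f, w.2.2.2) = ∑ t, g t := by
  rw [← Fintype.sum_prod_type']
  exact Fintype.sum_equiv
    ⟨fun t => (t.2.1, t.2.2.1, t.2.2.2.1, t.1, t.2.2.2.2),
      fun t => (t.2.2.2.1, t.1, t.2.1, t.2.2.1, t.2.2.2.2), fun _ => rfl, fun _ => rfl⟩
    _ _ fun _ => rfl

theorem sum_sum_shared_last {X Y Z F : Type*} [Fintype X] [Fintype Y] [Fintype Z] [Fintype F]
    (g : X × Y × Z × F → ℝ) :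
    ∑ f, ∑ w : X × Y × Z, g (w.1, w.2.1, w.2.2, f) = ∑ t, g t := by
  rw [← Fintype.sum_prod_type']
  exact Fintype.sum_equiv
    ⟨fun t => (t.2.1, t.2.2.1, t.2.2.2, t.1),
      fun t => (t.2.2.2, t.1, t.2.1, t.2.2.1), fun _ => rfl, fun _ => rfl⟩
    _ _ fun _ => rfl

variable {X Y Z F M : Type*}
variable [Fintype X] [Fintype Y] [Fintype Z] [Fintype F] [Fintype M]
variable [Nonempty X] [Nonempty Y] [Nonempty Z] [Nonempty F] [Nonempty M]

/-- **Claim 3.** If `p̄(x,y,z,f) ≈_ε p^U(f)·p(x,y,z)` and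
`p̂ ≈_δ p̄` (with `p̂` having uniform `F`-marginal), then there is an `f` with
`p̄(f) > 0`, `‖p̄(x,y,z|f) − p(x,y,z)‖₁ ≤ 3ε + δ` and
`‖p̂(x,y,z,m|f) − p̄(x,y,z,m|f)‖₁ ≤ 3ε + δ`. -/
theorem exists_good_shared_randomness
    (pbar phat : X × Y × Z × F × M → ℝ) (p : X × Y × Z → ℝ)
    (hpbar : IsPMF pbar) (hphat : IsPMF phat) (hp : IsPMF p)
    (hunif : ∀ f : F,
      (∑ w : X × Y × Z × M, phat (w.1, w.2.1, w.2.2.1, f, w.2.2.2))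
        = (Fintype.card F : ℝ)⁻¹)
    (ε δ : ℝ) (hε : 0 ≤ ε) (hδ : 0 ≤ δ)
    (h1 : tv (fun w : X × Y × Z × F => ∑ m, pbar (w.1, w.2.1, w.2.2.1, w.2.2.2, m))
            (fun w => (Fintype.card F : ℝ)⁻¹ * p (w.1, w.2.1, w.2.2.1)) ≤ ε)
    (h2 : tv phat pbar ≤ δ) :
    ∃ f : F,
      0 < (∑ w : X × Y × Z × M, pbar (w.1, w.2.1, w.2.2.1, f, w.2.2.2)) ∧
      tv (fun w : X × Y × Z =>
            (∑ m, pbar (w.1, w.2.1, w.2.2, f, m))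
              / (∑ w' : X × Y × Z × M, pbar (w'.1, w'.2.1, w'.2.2.1, f, w'.2.2.2)))
        p ≤ 3 * ε + δ ∧
      tv (fun w : X × Y × Z × M =>
            phat (w.1, w.2.1, w.2.2.1, f, w.2.2.2)
              / (∑ w' : X × Y × Z × M, phat (w'.1, w'.2.1, w'.2.2.1, f, w'.2.2.2)))
         (fun w : X × Y × Z × M =>
            pbar (w.1, w.2.1, w.2.2.1, f, w.2.2.2)
              / (∑ w' : X × Y × Z × M, pbar (w'.1, w'.2.1, w'.2.2.1, f, w'.2.2.2)))
        ≤ 3 * ε + δ := by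
  have hu : 0 < (Fintype.card F : ℝ)⁻¹ := inv_pos.2 (Nat.cast_pos.2 Fintype.card_pos)
  have hq : IsPMF fun f => ∑ w : X × Y × Z × M, pbar (w.1, w.2.1, w.2.2.1, f, w.2.2.2) :=
    ⟨fun f => Finset.sum_nonneg fun w _ => hpbar.1 _, (sum_sum_shared pbar).trans hpbar.2⟩
  have hA (f : F) : ∑ w : X × Y × Z, ∑ m, pbar (w.1, w.2.1, w.2.2, f, m) =
      ∑ w : X × Y × Z × M, pbar (w.1, w.2.1, w.2.2.1, f, w.2.2.2) := by
    simp only [Fintype.sum_prod_type]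
  have hd1 : ∑ f, tv (fun w : X × Y × Z => ∑ m, pbar (w.1, w.2.1, w.2.2, f, m))
      (fun w => (Fintype.card F : ℝ)⁻¹ * p w) ≤ ε := by
    refine le_of_eq_of_le ?_ h1
    simp only [tv, ← Finset.mul_sum]
    congr 1
    exact sum_sum_shared_last fun t : X × Y × Z × F =>
      |∑ m, pbar (t.1, t.2.1, t.2.2.1, t.2.2.2, m) -
        (Fintype.card F : ℝ)⁻¹ * p (t.1, t.2.1, t.2.2.1)|
  have hd2 : ∑ f, tv (fun w : X × Y × Z × M => phat (w.1, w.2.1, w.2.2.1, f, w.2.2.2))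
      (fun w => pbar (w.1, w.2.1, w.2.2.1, f, w.2.2.2)) ≤ δ := by
    refine le_of_eq_of_le ?_ h2
    simp only [tv, ← Finset.mul_sum]
    congr 1
    exact sum_sum_shared fun t => |phat t - pbar t|
  simp only [hunif]
  exact exists_pos_and_tv_div_le hu hq hp (fun _ _ => hphat.1 _) hA hunif hd1 hd2

end SC
end

section
/- In this setting, I(U; Y_T | X_T) = 0, i.e., the Markov chain U − X_T − Y_T holds. -/
open scoped BigOperators
open scoped Classical

namespace SC

/-- The law of `f` under `p`: the mass that `p` gives to the fibre of `f` over `b`. -/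
noncomputable def law {Ω β : Type*} [Fintype Ω] (p : Ω → ℝ) (f : Ω → β) (b : β) : ℝ :=
  ∑ a ∈ Finset.univ.filter (fun a => f a = b), p a

section Law

variable {Ω α β γ : Type*} [Fintype Ω] {p : Ω → ℝ}

theorem law_nonneg (hp : ∀ ω, 0 ≤ p ω) (f : Ω → β) (b : β) : 0 ≤ law p f b :=
  Finset.sum_nonneg fun ω _ => hp ω

theorem le_law (hp : ∀ ω, 0 ≤ p ω) (f : Ω → β) (ω : Ω) : p ω ≤ law p f (f ω) :=
  Finset.single_le_sum (f := p) (fun ω _ => hp ω) (by simp)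

theorem law_of_injective {f : Ω → β} (hf : Function.Injective f) (ω : Ω) :
    law p f (f ω) = p ω := by
  simp [law, hf.eq_iff, Finset.sum_filter]

theorem sum_mul_comp_eq_sum_law [Fintype β] (p : Ω → ℝ) (f : Ω → β) (F : β → ℝ) :
    ∑ ω, p ω * F (f ω) = ∑ b, law p f b * F b := by
  rw [← Finset.sum_fiberwise (s := Finset.univ) (g := f)]
  refine Finset.sum_congr rfl fun b _ => ?_
  rw [law, Finset.sum_mul]
  refine Finset.sum_congr rfl fun ω hω => ?_
  rw [(Finset.mem_filter.1 hω).2]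

theorem sum_law [Fintype β] (p : Ω → ℝ) (f : Ω → β) : ∑ b, law p f b = ∑ ω, p ω := by
  simpa using (sum_mul_comp_eq_sum_law p f fun _ => 1).symm

theorem sum_law_prodMk_left [Fintype α] (p : Ω → ℝ) (A : Ω → α) (B : Ω → β) (b : β) :
    ∑ a, law p (fun ω => (A ω, B ω)) (a, b) = law p B b := by
  simp only [law]
  rw [← Finset.sum_fiberwise (s := Finset.univ.filter fun ω => B ω = b) (g := A)]
  refine Finset.sum_congr rfl fun a _ => ?_
  rw [Finset.filter_filter]
  exact Finset.sum_congr (by ext; simp [and_comm]) fun _ _ => rfl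

theorem sum_law_prodMk_right [Fintype γ] (p : Ω → ℝ) (B : Ω → β) (C : Ω → γ) (b : β) :
    ∑ c, law p (fun ω => (B ω, C ω)) (b, c) = law p B b := by
  rw [← sum_law_prodMk_left p C B b]
  refine Finset.sum_congr rfl fun c _ => ?_
  exact Finset.sum_congr (by ext; simp [and_comm]) fun _ _ => rfl

theorem sum_law_triple_right [Fintype γ] (p : Ω → ℝ) (A : Ω → α) (B : Ω → β) (C : Ω → γ)
    (a : α) (b : β) :
    ∑ c, law p (fun ω => (A ω, B ω, C ω)) (a, b, c) = law p (fun ω => (A ω, B ω)) (a, b) := by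
  rw [← sum_law_prodMk_right p (fun ω => (A ω, B ω)) C (a, b)]
  refine Finset.sum_congr rfl fun c _ => ?_
  exact Finset.sum_congr (by ext; simp [and_assoc]) fun _ _ => rfl

theorem Hof_eq_neg_sum_mul_log_law (p : Ω → ℝ) (f : Ω → β) :
    Hof p f = -(∑ ω, p ω * Real.log (law p f (f ω))) / Real.log 2 := by
  rw [Hof, ← Finset.sum_fiberwise_of_maps_to (s := Finset.univ) (t := Finset.univ.image f)
    (g := f) (fun ω _ => Finset.mem_image_of_mem f (Finset.mem_univ ω)), ← Finset.sum_neg_distrib]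
  congr 1
  refine Finset.sum_congr rfl fun b _ => ?_
  rw [Real.negMulLog, neg_mul, Finset.sum_mul]
  congr 1
  refine Finset.sum_congr rfl fun ω hω => ?_
  rw [(Finset.mem_filter.1 hω).2, law]

theorem cmi_eq_sum_mul_log_law (p : Ω → ℝ) (A : Ω → α) (B : Ω → β) (C : Ω → γ) :
    cmi p A B C = (∑ ω, p ω * (Real.log (law p (fun ω => (A ω, B ω, C ω)) (A ω, B ω, C ω))
      + Real.log (law p B (B ω)) - Real.log (law p (fun ω => (A ω, B ω)) (A ω, B ω))
      - Real.log (law p (fun ω => (B ω, C ω)) (B ω, C ω)))) / Real.log 2 := by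
  simp only [cmi, Hof_eq_neg_sum_mul_log_law, mul_add, mul_sub, Finset.sum_add_distrib,
    Finset.sum_sub_distrib]
  ring

/-- Equality case of Gibbs' inequality. -/
theorem eq_of_sum_mul_log_sub_log_eq_zero {ι : Type*} [Fintype ι] {P Q : ι → ℝ}
    (hP : ∀ i, 0 ≤ P i) (hQ : ∀ i, 0 ≤ Q i) (hPQ : ∀ i, Q i = 0 → P i = 0)
    (hsum : ∑ i, P i = ∑ i, Q i)
    (hzero : ∑ i, P i * (Real.log (P i) - Real.log (Q i)) = 0) (i : ι) : P i = Q i := by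
  have key : ∀ i, Q i * InformationTheory.klFun (P i / Q i)
      = P i * (Real.log (P i) - Real.log (Q i)) + Q i - P i := by
    intro i
    by_cases hq : Q i = 0
    · simp [hq, hPQ i hq]
    by_cases h0 : P i = 0
    · simp [h0, InformationTheory.klFun]
    · rw [InformationTheory.klFun, Real.log_div h0 hq]
      field_simp
  have hkl : ∀ i, 0 ≤ Q i * InformationTheory.klFun (P i / Q i) := fun i =>
    mul_nonneg (hQ i) (InformationTheory.klFun_nonneg (div_nonneg (hP i) (hQ i)))
  have h0 : ∑ i, Q i * InformationTheory.klFun (P i / Q i) = 0 := by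
    simp only [key, Finset.sum_sub_distrib, Finset.sum_add_distrib]
    linarith
  have hi := (Finset.sum_eq_zero_iff_of_nonneg fun i _ => hkl i).1 h0 i (Finset.mem_univ i)
  rcases mul_eq_zero.1 hi with hq | hk
  · rw [hq, hPQ i hq]
  · have h1 := (InformationTheory.klFun_eq_zero_iff (div_nonneg (hP i) (hQ i))).1 hk
    exact eq_of_div_eq_one h1

theorem law_mul_law_eq_of_cmi_eq_zero [Fintype α] [Fintype β] [Fintype γ]
    (hp : ∀ ω, 0 ≤ p ω) {A : Ω → α} {B : Ω → β} {C : Ω → γ} (h : cmi p A B C = 0)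
    (a : α) (b : β) (c : γ) :
    law p (fun ω => (A ω, B ω, C ω)) (a, b, c) * law p B b
      = law p (fun ω => (A ω, B ω)) (a, b) * law p (fun ω => (B ω, C ω)) (b, c) := by
  set P : α × β × γ → ℝ := law p fun ω => (A ω, B ω, C ω) with hPdef
  set PAB : α × β → ℝ := law p fun ω => (A ω, B ω) with hPAB
  set PBC : β × γ → ℝ := law p fun ω => (B ω, C ω) with hPBC
  set PB : β → ℝ := law p B with hPB
  have hP : ∀ x, 0 ≤ P x := law_nonneg hp _
  have hAB : ∀ x, 0 ≤ PAB x := law_nonneg hp _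
  have hBC : ∀ x, 0 ≤ PBC x := law_nonneg hp _
  have hB : ∀ x, 0 ≤ PB x := law_nonneg hp _
  have sA : ∀ b, ∑ a, PAB (a, b) = PB b := sum_law_prodMk_left p A B
  have sC : ∀ b, ∑ c, PBC (b, c) = PB b := sum_law_prodMk_right p B C
  have leAB : ∀ a b c, P (a, b, c) ≤ PAB (a, b) := fun a b c => by
    rw [hPAB, ← sum_law_triple_right p A B C a b]
    exact Finset.single_le_sum (f := fun c => P (a, b, c)) (fun c _ => hP _) (Finset.mem_univ c)
  have leBC : ∀ a b c, P (a, b, c) ≤ PBC (b, c) := fun a b c => by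
    rw [hPBC, ← sum_law_prodMk_left p A (fun ω => (B ω, C ω)) (b, c)]
    exact Finset.single_le_sum (f := fun a => P (a, b, c)) (fun a _ => hP _) (Finset.mem_univ a)
  have leB : ∀ a b, PAB (a, b) ≤ PB b := fun a b => by
    rw [← sA b]
    exact Finset.single_le_sum (f := fun a => PAB (a, b)) (fun a _ => hAB _) (Finset.mem_univ a)
  have hpos : ∀ a b c, P (a, b, c) ≠ 0 → 0 < PAB (a, b) ∧ 0 < PBC (b, c) ∧ 0 < PB b := by
    intro a b c h0
    have h1 := lt_of_le_of_ne (hP (a, b, c)) h0.symm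
    exact ⟨h1.trans_le (leAB a b c), h1.trans_le (leBC a b c),
      (h1.trans_le (leAB a b c)).trans_le (leB a b)⟩
  have hPQ := eq_of_sum_mul_log_sub_log_eq_zero (P := P)
    (Q := fun x => PAB (x.1, x.2.1) * PBC x.2 / PB x.2.1) hP
    (fun x => div_nonneg (mul_nonneg (hAB _) (hBC _)) (hB _)) ?_ ?_ ?_ (a, b, c)
  · by_cases h0 : PB b = 0
    · have h1 : PAB (a, b) = 0 := le_antisymm (h0 ▸ leB a b) (hAB _)
      rw [h0, h1, mul_zero, zero_mul]
    · rw [hPQ]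
      field_simp
  · rintro ⟨a, b, c⟩ h0
    by_contra h1
    obtain ⟨h2, h3, h4⟩ := hpos a b c h1
    exact (div_pos (mul_pos h2 h3) h4).ne' h0
  · rw [hPdef, sum_law, ← sum_law p B, Fintype.sum_prod_type_right]
    rw [Fintype.sum_prod_type]
    refine Finset.sum_congr rfl fun b _ => ?_
    simp only [← Finset.sum_div, ← Finset.sum_mul, ← Finset.mul_sum, sA, sC]
    by_cases h0 : PB b = 0
    · simp [← hPB, h0]
    · rw [mul_div_cancel_right₀ _ h0]
  · rw [cmi_eq_sum_mul_log_law, div_eq_zero_iff,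
      or_iff_left (Real.log_pos one_lt_two).ne',
      sum_mul_comp_eq_sum_law p (fun ω => (A ω, B ω, C ω)) (fun x => Real.log (P x)
        + Real.log (PB x.2.1) - Real.log (PAB (x.1, x.2.1)) - Real.log (PBC x.2))] at h
    rw [← h]
    refine Finset.sum_congr rfl ?_
    rintro ⟨a, b, c⟩ -
    by_cases h0 : P (a, b, c) = 0
    · simp [← hPdef, h0]
    · obtain ⟨h2, h3, h4⟩ := hpos a b c h0
      simp only
      rw [Real.log_div (mul_pos h2 h3).ne' h4.ne', Real.log_mul h2.ne' h3.ne']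
      ring

theorem cmi_eq_zero_of_law_mul_law_eq (hp : ∀ ω, 0 ≤ p ω) {A : Ω → α} {B : Ω → β} {C : Ω → γ}
    (h : ∀ a b c, law p (fun ω => (A ω, B ω, C ω)) (a, b, c) * law p B b
      = law p (fun ω => (A ω, B ω)) (a, b) * law p (fun ω => (B ω, C ω)) (b, c)) :
    cmi p A B C = 0 := by
  rw [cmi_eq_sum_mul_log_law, Finset.sum_eq_zero, zero_div]
  intro ω _
  by_cases h0 : p ω = 0
  · rw [h0, zero_mul]
  have h1 := lt_of_le_of_ne (hp ω) (Ne.symm h0)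
  have hABC := (h1.trans_le (le_law hp (fun ω => (A ω, B ω, C ω)) ω)).ne'
  have hAB := (h1.trans_le (le_law hp (fun ω => (A ω, B ω)) ω)).ne'
  have hBC := (h1.trans_le (le_law hp (fun ω => (B ω, C ω)) ω)).ne'
  have hB := (h1.trans_le (le_law hp B ω)).ne'
  have h2 := congrArg Real.log (h (A ω) (B ω) (C ω))
  rw [Real.log_mul hABC hB, Real.log_mul hAB hBC] at h2
  rw [mul_eq_zero]
  right
  linarith

/-- `A − B − C` is a Markov chain as soon as the joint law is a function of `(A, B)` times a
function of `(B, C)`. -/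
theorem cmi_eq_zero_of_law_eq_mul [Fintype α] [Fintype γ] (hp : ∀ ω, 0 ≤ p ω)
    {A : Ω → α} {B : Ω → β} {C : Ω → γ} (g : α → β → ℝ) (K : β → γ → ℝ)
    (h : ∀ a b c, law p (fun ω => (A ω, B ω, C ω)) (a, b, c) = g a b * K b c) :
    cmi p A B C = 0 := by
  refine cmi_eq_zero_of_law_mul_law_eq hp fun a b c => ?_
  have hAB : ∀ a, law p (fun ω => (A ω, B ω)) (a, b) = g a b * ∑ c, K b c := fun a => by
    simp only [← sum_law_triple_right p A B C, h, Finset.mul_sum]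
  have hBC : law p (fun ω => (B ω, C ω)) (b, c) = (∑ a, g a b) * K b c := by
    simp only [← sum_law_prodMk_left p A (fun ω => (B ω, C ω)), h, Finset.sum_mul]
  rw [← sum_law_prodMk_left p A B, h, hBC]
  simp only [hAB, ← Finset.sum_mul]
  ring

end Law

/-- A memoryless channel: if `(Xⁿ, Yⁿ)` is i.i.d. and `M − Xⁿ − Yⁿ` is a Markov chain, then the
joint pmf is the law of `(M, Xⁿ)` times the product of the single-letter conditionals. -/
theorem eq_law_mul_prod_of_cmi_eq_zero {𝒳 𝒴 ℳ ι : Type*} [Fintype 𝒳] [Fintype 𝒴] [Fintype ℳ]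
    [Fintype ι] [DecidableEq ι] {pXY : 𝒳 × 𝒴 → ℝ} {μ : ℳ × (ι → 𝒳) × (ι → 𝒴) → ℝ} (hμ : ∀ w, 0 ≤ μ w)
    (hiid : ∀ (xs : ι → 𝒳) (ys : ι → 𝒴), (∑ m, μ (m, xs, ys)) = ∏ i, pXY (xs i, ys i))
    (hMC : cmi μ (fun w => w.1) (fun w => w.2.1) (fun w => w.2.2) = 0)
    (m : ℳ) (xs : ι → 𝒳) (ys : ι → 𝒴) :
    μ (m, xs, ys) = law μ (fun w => (w.1, w.2.1)) (m, xs)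
      * ∏ i, pXY (xs i, ys i) / ∑ y, pXY (xs i, y) := by
  have hABC : ∀ m xs ys, law μ (fun w => (w.1, w.2.1, w.2.2)) (m, xs, ys) = μ (m, xs, ys) :=
    fun m xs ys => law_of_injective (f := fun w : ℳ × (ι → 𝒳) × (ι → 𝒴) => (w.1, w.2.1, w.2.2))
      Function.injective_id (m, xs, ys)
  have hBC : ∀ xs ys, law μ (fun w => (w.2.1, w.2.2)) (xs, ys) = ∏ i, pXY (xs i, ys i) :=
    fun xs ys => by
      rw [← hiid, ← sum_law_prodMk_left μ (fun w => w.1) (fun w => (w.2.1, w.2.2))]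
      exact Finset.sum_congr rfl fun m _ => hABC m xs ys
  have hB : law μ (fun w => w.2.1) xs = ∏ i, ∑ y, pXY (xs i, y) := by
    rw [← sum_law_prodMk_right μ (fun w => w.2.1) (fun w => w.2.2), Finset.prod_univ_sum,
      Fintype.piFinset_univ]
    exact Finset.sum_congr rfl fun ys _ => hBC xs ys
  have hfac := law_mul_law_eq_of_cmi_eq_zero hμ hMC m xs ys
  rw [hABC, hBC, hB] at hfac
  rw [Finset.prod_div_distrib, ← mul_div_assoc, ← hfac]
  by_cases h0 : ∏ i, ∑ y, pXY (xs i, y) = 0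
  · rw [h0, div_zero]
    exact le_antisymm ((le_law hμ (fun w => w.2.1) (m, xs, ys)).trans_eq (hB.trans h0)) (hμ _)
  · rw [mul_div_cancel_right₀ _ h0]

variable {𝒳 𝒴 : Type*} [Fintype 𝒳] [Fintype 𝒴] [Nonempty 𝒳] [Nonempty 𝒴]

/-- With `(Xⁿ, Yⁿ)` i.i.d. `~ p_XY`, the Markov chain `M − Xⁿ − Yⁿ`,
`T` uniform and independent, and `U = (X^{T−1}, M, Y^{T−1}, Y_{T+1}^n, T)`, the Markov
chain `U − X_T − Y_T` holds, i.e. `I(U; Y_T | X_T) = 0`. -/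
theorem single_letter_markov_UXY
    (pXY : 𝒳 × 𝒴 → ℝ) (hpXY : IsPMF pXY)
    (n : ℕ) (hn : 0 < n) (ℳ : Type*) [Fintype ℳ] [Nonempty ℳ]
    (μ : ℳ × (Fin n → 𝒳) × (Fin n → 𝒴) → ℝ) (hμ : IsPMF μ)
    (hiid : ∀ (xs : Fin n → 𝒳) (ys : Fin n → 𝒴),
      (∑ m, μ (m, xs, ys)) = ∏ i, pXY (xs i, ys i))
    (hMC : cmi μ (fun w => w.1) (fun w => w.2.1) (fun w => w.2.2) = 0) :
    cmi (fun w : Fin n × ℳ × (Fin n → 𝒳) × (Fin n → 𝒴) => (n : ℝ)⁻¹ * μ w.2)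
      (fun w =>
        ((fun i : Fin n => if (i : ℕ) < (w.1 : ℕ) then some (w.2.2.1 i) else none),
         w.2.1,
         (fun i : Fin n => if i ≠ w.1 then some (w.2.2.2 i) else none),
         w.1))
      (fun w => w.2.2.1 w.1) (fun w => w.2.2.2 w.1) = 0 := by
  set W : 𝒳 → 𝒴 → ℝ := fun x y => pXY (x, y) / ∑ y, pXY (x, y)
  have hfac := eq_law_mul_prod_of_cmi_eq_zero hμ.1 hiid hMC
  let h : Fin n × ℳ × (Fin n → 𝒳) × (Fin n → 𝒴) → ℝ := fun w =>
    (n : ℝ)⁻¹ * law μ (fun w => (w.1, w.2.1)) (w.2.1, w.2.2.1)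
      * ∏ i ∈ Finset.univ.erase w.1, W (w.2.2.1 i) (w.2.2.2 i)
  have hh : ∀ w, (n : ℝ)⁻¹ * μ w.2 = h w * W (w.2.2.1 w.1) (w.2.2.2 w.1) := by
    rintro ⟨t, m, xs, ys⟩
    simp only [h]
    rw [hfac, mul_assoc, mul_assoc, Finset.prod_erase_mul Finset.univ
      (fun i => W (xs i) (ys i)) (Finset.mem_univ t)]
  obtain ⟨y₀⟩ := ‹Nonempty 𝒴›
  refine cmi_eq_zero_of_law_eq_mul
    (fun w => mul_nonneg (inv_nonneg.2 n.cast_nonneg) (hμ.1 _))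
    (fun a b => law h (fun w =>
        (((fun i : Fin n => if (i : ℕ) < (w.1 : ℕ) then some (w.2.2.1 i) else none),
         w.2.1,
         (fun i : Fin n => if i ≠ w.1 then some (w.2.2.2 i) else none),
         w.1), w.2.2.1 w.1, w.2.2.2 w.1)) (a, b, y₀)) W fun a b c => ?_
  simp only [law]
  rw [Finset.sum_mul]
  refine Finset.sum_bij'
    (fun w _ => (w.1, w.2.1, w.2.2.1, Function.update w.2.2.2 w.1 y₀))
    (fun w _ => (w.1, w.2.1, w.2.2.1, Function.update w.2.2.2 w.1 c)) ?_ ?_ ?_ ?_ ?_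
  · rintro ⟨t, m, xs, ys⟩ hw
    simp only [Finset.mem_filter, Finset.mem_univ, true_and, Prod.mk.injEq] at hw ⊢
    obtain ⟨rfl, rfl, rfl⟩ := hw
    simp only [Function.update_self, and_true, Prod.mk.injEq, true_and]
    funext i
    by_cases hi : i = t <;> simp [hi]
  · rintro ⟨t, m, xs, ys⟩ hw
    simp only [Finset.mem_filter, Finset.mem_univ, true_and, Prod.mk.injEq] at hw ⊢
    obtain ⟨rfl, rfl, -⟩ := hw
    simp only [Function.update_self, and_true, Prod.mk.injEq, true_and]
    funext i
    by_cases hi : i = t <;> simp [hi]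
  · rintro ⟨t, m, xs, ys⟩ hw
    simp only [Finset.mem_filter, Finset.mem_univ, true_and, Prod.mk.injEq] at hw
    obtain ⟨-, -, rfl⟩ := hw
    simp
  · rintro ⟨t, m, xs, ys⟩ hw
    simp only [Finset.mem_filter, Finset.mem_univ, true_and, Prod.mk.injEq] at hw
    obtain ⟨-, -, hy⟩ := hw
    simp [← hy]
  · rintro ⟨t, m, xs, ys⟩ hw
    rw [hh]
    simp only [Finset.mem_filter, Finset.mem_univ, true_and, Prod.mk.injEq] at hw
    obtain ⟨-, rfl, rfl⟩ := hw
    simp only [h]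
    congr 2
    refine Finset.prod_congr rfl fun i hi => ?_
    rw [Function.update_of_ne (Finset.ne_of_mem_erase hi)]

end SC
end

section
/- In this setting, I(X_T; Ẑ_T | U, Y_T) = 0, i.e., the Markov chain Ẑ_T − (U, Y_T) − X_T holds. -/
open scoped BigOperators
open scoped Classical

namespace SC

/-- The probability that `f = b` under the weights `p`. -/
noncomputable def marg {Ω β : Type*} [Fintype Ω] (p : Ω → ℝ) (f : Ω → β) (b : β) : ℝ :=
  ∑ a ∈ Finset.univ.filter (fun a => f a = b), p a

section Marginals

variable {Ω α β γ : Type*} [Fintype Ω] {p : Ω → ℝ}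

theorem marg_nonneg (hp : ∀ a, 0 ≤ p a) (f : Ω → β) (b : β) : 0 ≤ marg p f b :=
  Finset.sum_nonneg fun a _ => hp a

theorem marg_le_marg (hp : ∀ a, 0 ≤ p a) {f : Ω → α} {g : Ω → β} {a : α} {b : β}
    (h : ∀ ω, f ω = a → g ω = b) : marg p f a ≤ marg p g b :=
  Finset.sum_le_sum_of_subset_of_nonneg
    (fun ω hω => by
      simp only [Finset.mem_filter, Finset.mem_univ, true_and] at hω ⊢
      exact h ω hω)
    fun ω _ _ => hp ω

theorem le_marg_self (hp : ∀ a, 0 ≤ p a) (f : Ω → β) (ω : Ω) : p ω ≤ marg p f (f ω) :=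
  Finset.single_le_sum (f := p) (fun a _ => hp a) (by simp)

theorem sum_mul_comp [Fintype β] (p : Ω → ℝ) (f : Ω → β) (φ : β → ℝ) :
    ∑ ω, p ω * φ (f ω) = ∑ b, marg p f b * φ b := by
  rw [← Finset.sum_fiberwise Finset.univ f]
  refine Finset.sum_congr rfl fun b _ => ?_
  rw [marg, Finset.sum_mul]
  refine Finset.sum_congr rfl fun ω hω => ?_
  rw [(Finset.mem_filter.mp hω).2]

theorem sum_marg_prodMk_left [Fintype α] (p : Ω → ℝ) (A : Ω → α) (B : Ω → β) (b : β) :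
    ∑ a, marg p (fun ω => (A ω, B ω)) (a, b) = marg p B b := by
  rw [marg, ← Finset.sum_fiberwise _ A]
  refine Finset.sum_congr rfl fun a _ => ?_
  rw [marg, Finset.filter_filter]
  simp only [Prod.mk.injEq, and_comm]

theorem sum_marg_prodMk_right [Fintype γ] (p : Ω → ℝ) (B : Ω → β) (C : Ω → γ) (b : β) :
    ∑ c, marg p (fun ω => (B ω, C ω)) (b, c) = marg p B b := by
  rw [marg, ← Finset.sum_fiberwise _ C]
  refine Finset.sum_congr rfl fun c _ => ?_
  rw [marg, Finset.filter_filter]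
  simp only [Prod.mk.injEq]

theorem Hof_eq_sum (p : Ω → ℝ) (f : Ω → β) :
    Hof p f = (∑ ω, p ω * -Real.log (marg p f (f ω))) / Real.log 2 := by
  rw [Hof]
  congr 1
  rw [← Finset.sum_fiberwise_of_maps_to (s := Finset.univ) (t := Finset.univ.image f) (g := f)
    (fun ω _ => Finset.mem_image_of_mem f (Finset.mem_univ ω))]
  refine Finset.sum_congr rfl fun b _ => ?_
  rw [Real.negMulLog, neg_mul_comm, Finset.sum_mul]
  refine Finset.sum_congr rfl fun ω hω => ?_
  rw [(Finset.mem_filter.mp hω).2, marg]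

theorem cmi_eq_sum (p : Ω → ℝ) (A : Ω → α) (B : Ω → β) (C : Ω → γ) :
    cmi p A B C = (∑ ω, p ω *
      (Real.log (marg p (fun ω => (A ω, B ω, C ω)) (A ω, B ω, C ω)) + Real.log (marg p B (B ω))
        - Real.log (marg p (fun ω => (A ω, B ω)) (A ω, B ω))
        - Real.log (marg p (fun ω => (B ω, C ω)) (B ω, C ω)))) / Real.log 2 := by
  simp only [cmi, Hof_eq_sum, mul_sub, mul_add, mul_neg, Finset.sum_add_distrib,
    Finset.sum_sub_distrib, Finset.sum_neg_distrib]
  ring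

theorem cmi_eq_zero_of_marg_mul (hp : ∀ a, 0 ≤ p a) {A : Ω → α} {B : Ω → β} {C : Ω → γ}
    (h : ∀ ω, marg p (fun ω => (A ω, B ω, C ω)) (A ω, B ω, C ω) * marg p B (B ω) =
      marg p (fun ω => (A ω, B ω)) (A ω, B ω) * marg p (fun ω => (B ω, C ω)) (B ω, C ω)) :
    cmi p A B C = 0 := by
  rw [cmi_eq_sum, Finset.sum_eq_zero, zero_div]
  intro ω _
  rcases (hp ω).eq_or_lt with h0 | h0
  · rw [← h0, zero_mul]
  · have h1 := h0.trans_le (le_marg_self hp (fun ω => (A ω, B ω, C ω)) ω)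
    have h2 := h0.trans_le (le_marg_self hp B ω)
    have h3 := h0.trans_le (le_marg_self hp (fun ω => (A ω, B ω)) ω)
    have h4 := h0.trans_le (le_marg_self hp (fun ω => (B ω, C ω)) ω)
    have := congrArg Real.log (h ω)
    rw [Real.log_mul h1.ne' h2.ne', Real.log_mul h3.ne' h4.ne'] at this
    rw [this]
    ring

theorem sub_le_mul_log_sub_log {x y : ℝ} (hx : 0 ≤ x) (hy : 0 ≤ y) (hxy : 0 < x → 0 < y) :
    x - y ≤ x * (Real.log x - Real.log y) := by
  rcases hx.eq_or_lt with rfl | hx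
  · simpa using hy
  · have := Real.log_le_sub_one_of_pos (div_pos (hxy hx) hx)
    rw [Real.log_div (hxy hx).ne' hx.ne'] at this
    have := mul_le_mul_of_nonneg_left this hx.le
    rw [mul_sub, mul_sub, mul_div_cancel₀ _ hx.ne'] at this
    linarith

theorem eq_of_sub_eq_mul_log_sub_log {x y : ℝ} (hx : 0 ≤ x) (hxy : 0 < x → 0 < y)
    (h : x - y = x * (Real.log x - Real.log y)) : x = y := by
  rcases hx.eq_or_lt with rfl | hx
  · simpa [eq_comm] using h
  · by_contra hne
    have := Real.log_lt_sub_one_of_pos (div_pos (hxy hx) hx)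
      (fun h1 => hne ((div_eq_one_iff_eq hx.ne').mp h1).symm)
    rw [Real.log_div (hxy hx).ne' hx.ne'] at this
    have := mul_lt_mul_of_pos_left this hx
    rw [mul_sub, mul_sub, mul_div_cancel₀ _ hx.ne'] at this
    linarith

theorem marg_eq_of_cmi_eq_zero [Fintype α] [Fintype β] [Fintype γ] (hp : ∀ a, 0 ≤ p a)
    {A : Ω → α} {B : Ω → β} {C : Ω → γ} (h : cmi p A B C = 0) (a : α) (b : β) (c : γ) :
    marg p (fun ω => (A ω, B ω, C ω)) (a, b, c) =
      marg p (fun ω => (A ω, B ω)) (a, b) * marg p (fun ω => (B ω, C ω)) (b, c) /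
        marg p B b := by
  set P : α × β × γ → ℝ := marg p (fun ω => (A ω, B ω, C ω)) with hP
  set Q : α × β × γ → ℝ := fun x => marg p (fun ω => (A ω, B ω)) (x.1, x.2.1) *
    marg p (fun ω => (B ω, C ω)) (x.2.1, x.2.2) / marg p B x.2.1 with hQ
  have hP0 : ∀ x, 0 ≤ P x := marg_nonneg hp _
  have hQ0 : ∀ x, 0 ≤ Q x := fun x =>
    div_nonneg (mul_nonneg (marg_nonneg hp _ _) (marg_nonneg hp _ _)) (marg_nonneg hp _ _)
  have hpos : ∀ x, 0 < P x → 0 < marg p (fun ω => (A ω, B ω)) (x.1, x.2.1) ∧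
      0 < marg p (fun ω => (B ω, C ω)) (x.2.1, x.2.2) ∧ 0 < marg p B x.2.1 := by
    rintro x hx
    refine ⟨hx.trans_le (marg_le_marg hp ?_), hx.trans_le (marg_le_marg hp ?_),
      hx.trans_le (marg_le_marg hp ?_)⟩ <;>
    · rintro ω rfl
      rfl
  have hPQ : ∀ x, 0 < P x → 0 < Q x := fun x hx =>
    div_pos (mul_pos (hpos x hx).1 (hpos x hx).2.1) (hpos x hx).2.2
  have hlog : ∑ x, P x * (Real.log (P x) - Real.log (Q x)) = 0 := by
    rw [cmi_eq_sum, div_eq_zero_iff,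
      or_iff_left (Real.log_pos one_lt_two).ne'] at h
    have h' := sum_mul_comp p (fun ω => (A ω, B ω, C ω)) (fun x => Real.log (P x)
      + Real.log (marg p B x.2.1) - Real.log (marg p (fun ω => (A ω, B ω)) (x.1, x.2.1))
      - Real.log (marg p (fun ω => (B ω, C ω)) (x.2.1, x.2.2)))
    rw [← h, h']
    refine Finset.sum_congr rfl fun x _ => ?_
    rcases (hP0 x).eq_or_lt with h0 | h0
    · rw [← hP, ← h0, zero_mul, zero_mul]
    · obtain ⟨h1, h2, h3⟩ := hpos x h0
      rw [hQ, Real.log_div (mul_pos h1 h2).ne' h3.ne', Real.log_mul h1.ne' h2.ne']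
      ring
  have hsumP : ∑ x, P x = ∑ b, marg p B b := by
    have h1 := sum_mul_comp p (fun ω => (A ω, B ω, C ω)) (fun _ => 1)
    have h2 := sum_mul_comp p B (fun _ => 1)
    simp only [mul_one] at h1 h2
    rw [← h2, h1]
  have hsumQ : ∑ x, Q x = ∑ b, marg p B b := by
    rw [Fintype.sum_prod_type_right, Fintype.sum_prod_type]
    refine Finset.sum_congr rfl fun b _ => ?_
    simp only [hQ, ← Finset.sum_div, ← Finset.sum_mul, ← Finset.mul_sum, sum_marg_prodMk_left,
      sum_marg_prodMk_right, mul_self_div_self]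
  have hle : ∀ x ∈ Finset.univ, P x - Q x ≤ P x * (Real.log (P x) - Real.log (Q x)) :=
    fun x _ => sub_le_mul_log_sub_log (hP0 x) (hQ0 x) (hPQ x)
  have hsum : ∑ x, (P x - Q x) = ∑ x, P x * (Real.log (P x) - Real.log (Q x)) := by
    rw [hlog, Finset.sum_sub_distrib, hsumP, hsumQ, sub_self]
  exact eq_of_sub_eq_mul_log_sub_log (hP0 _) (hPQ _)
    ((Finset.sum_eq_sum_iff_of_le hle).mp hsum (a, b, c) (Finset.mem_univ _))

end Marginals

/-- If the weights factor as `k F(m, y, z) G(m, x, y)`, then so does any marginal that fixes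
`t`, `m`, `y` and constrains `x` and `z` separately. -/
theorem marg_eq_mul_of_factor {τ ι α β γ δ : Type*} [Fintype τ] [Fintype ι] [Fintype α]
    [Fintype β] [Fintype γ] {p : τ × ι × α × β × γ → ℝ} {k : ℝ} {F : ι → β → γ → ℝ}
    {G : ι → α → β → ℝ} (hp : ∀ t m x y z, p (t, m, x, y, z) = k * (F m y z * G m x y))
    {f : τ × ι × α × β × γ → δ} {d : δ} {t : τ} {m : ι} {y : β} {R : α → Prop} {S : γ → Prop}
    (hf : ∀ t' m' x' y' z', f (t', m', x', y', z') = d ↔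
      t' = t ∧ m' = m ∧ y' = y ∧ R x' ∧ S z') :
    marg p f d = k * ((∑ z, if S z then F m y z else 0) * ∑ x, if R x then G m x y else 0) := by
  rw [marg, Finset.sum_filter]
  simp only [Fintype.sum_prod_type, hf, hp]
  rw [Finset.sum_eq_single t, Finset.sum_eq_single m, Finset.sum_mul_sum, Finset.sum_comm,
    Finset.mul_sum]
  rotate_left
  · intro m' _ hm
    simp [hm]
  · simp
  · intro t' _ ht
    simp [ht]
  · simp
  rw [Finset.sum_eq_single y]
  rotate_left
  · intro y' _ hy
    simp [hy]
  · simp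
  rw [Finset.sum_comm]
  refine Finset.sum_congr rfl fun z _ => ?_
  rw [Finset.mul_sum]
  refine Finset.sum_congr rfl fun x _ => ?_
  by_cases hR : R x <;> by_cases hS : S z <;> simp [hR, hS]

variable {𝒳 𝒴 𝒵 : Type*} [Fintype 𝒳] [Fintype 𝒴] [Fintype 𝒵]
variable [Nonempty 𝒳] [Nonempty 𝒴] [Nonempty 𝒵]

/-- With `(Xⁿ, Yⁿ)` i.i.d. `~ p_XY`, the Markov chains
`M − Xⁿ − Yⁿ` and `Ẑⁿ − (M, Yⁿ) − Xⁿ`, `T` uniform and independent, and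
`U = (X^{T−1}, M, Y^{T−1}, Y_{T+1}^n, T)`, the Markov chain `Ẑ_T − (U, Y_T) − X_T`
holds, i.e. `I(X_T; Ẑ_T | U, Y_T) = 0`. -/
theorem single_letter_markov_ZUYX
    (pXY : 𝒳 × 𝒴 → ℝ) (hpXY : IsPMF pXY)
    (n : ℕ) (hn : 0 < n) (ℳ : Type*) [Fintype ℳ] [Nonempty ℳ]
    (μ : ℳ × (Fin n → 𝒳) × (Fin n → 𝒴) × (Fin n → 𝒵) → ℝ) (hμ : IsPMF μ)
    (hiid : ∀ (xs : Fin n → 𝒳) (ys : Fin n → 𝒴),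
      (∑ m, ∑ zs, μ (m, xs, ys, zs)) = ∏ i, pXY (xs i, ys i))
    (hMC1 : cmi μ (fun w => w.1) (fun w => w.2.1) (fun w => w.2.2.1) = 0)
    (hMC2 : cmi μ (fun w => w.2.2.2) (fun w => (w.1, w.2.2.1)) (fun w => w.2.1) = 0) :
    cmi (fun w : Fin n × ℳ × (Fin n → 𝒳) × (Fin n → 𝒴) × (Fin n → 𝒵) =>
          (n : ℝ)⁻¹ * μ w.2)
      (fun w => w.2.2.2.2 w.1)
      (fun w =>
        (((fun i : Fin n => if (i : ℕ) < (w.1 : ℕ) then some (w.2.2.1 i) else none),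
          w.2.1,
          (fun i : Fin n => if i ≠ w.1 then some (w.2.2.2.1 i) else none),
          w.1),
         w.2.2.2.1 w.1))
      (fun w => w.2.2.1 w.1) = 0 := by
  have hfac : ∀ m x y z, μ (m, x, y, z) =
      marg μ (fun w => (w.2.2.2, w.1, w.2.2.1)) (z, m, y) *
        (marg μ (fun w => ((w.1, w.2.2.1), w.2.1)) ((m, y), x) /
          marg μ (fun w => (w.1, w.2.2.1)) (m, y)) := by
    intro m x y z
    rw [← mul_div_assoc, ← marg_eq_of_cmi_eq_zero hμ.1 hMC2 z (m, y) x, marg, Finset.sum_filter,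
      Finset.sum_eq_single (m, x, y, z)]
    · simp
    · rintro ⟨m', x', y', z'⟩ _ hne
      refine if_neg fun h => hne ?_
      simp only [Prod.mk.injEq] at h ⊢
      tauto
    · simp
  have hp : ∀ (t : Fin n) m x y z, (n : ℝ)⁻¹ * μ (t, m, x, y, z).2 = _ := fun t m x y z =>
    congrArg ((n : ℝ)⁻¹ * ·) (hfac m x y z)
  refine cmi_eq_zero_of_marg_mul (fun w => mul_nonneg (by positivity) (hμ.1 _)) ?_
  rintro ⟨t, m, x, y, z⟩
  have hX : ∀ x' : Fin n → 𝒳, ((fun i : Fin n => if (i : ℕ) < (t : ℕ) then some (x' i) else none)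
      = fun i : Fin n => if (i : ℕ) < (t : ℕ) then some (x i) else none) ↔
      ∀ i : Fin n, (i : ℕ) < (t : ℕ) → x' i = x i := by
    intro x'
    rw [funext_iff]
    refine forall_congr' fun i => ?_
    split_ifs with h <;> simp [h]
  have hY : ∀ y' : Fin n → 𝒴, ((fun i : Fin n => if i ≠ t then some (y' i) else none)
      = fun i : Fin n => if i ≠ t then some (y i) else none) ∧ y' t = y t ↔ y' = y := by
    intro y'
    simp only [funext_iff]
    refine ⟨fun ⟨h1, h2⟩ i => ?_, fun h => ⟨fun i => by rw [h i], h t⟩⟩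
    rcases eq_or_ne i t with rfl | hi
    · exact h2
    · simpa [hi] using h1 i
  set R : (Fin n → 𝒳) → Prop := fun x' => ∀ i : Fin n, (i : ℕ) < (t : ℕ) → x' i = x i
  have key : ∀ (t' : Fin n) (m' : ℳ) (x' : Fin n → 𝒳) (y' : Fin n → 𝒴),
      ((((fun i : Fin n => if (i : ℕ) < (t' : ℕ) then some (x' i) else none), m',
        (fun i : Fin n => if i ≠ t' then some (y' i) else none), t'), y' t') =
      (((fun i : Fin n => if (i : ℕ) < (t : ℕ) then some (x i) else none), m,
        (fun i : Fin n => if i ≠ t then some (y i) else none), t), y t)) ↔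
      t' = t ∧ m' = m ∧ y' = y ∧ R x' := by
    intro t' m' x' y'
    rw [Prod.mk.injEq, Prod.mk.injEq, Prod.mk.injEq, Prod.mk.injEq]
    constructor
    · rintro ⟨⟨h1, h2, h3, rfl⟩, h4⟩
      exact ⟨rfl, h2, (hY y').mp ⟨h3, h4⟩, (hX x').mp h1⟩
    · rintro ⟨rfl, h2, h3, h4⟩
      exact ⟨⟨(hX x').mpr h4, h2, ((hY y').mpr h3).1, rfl⟩, ((hY y').mpr h3).2⟩
  rw [marg_eq_mul_of_factor hp (t := t) (m := m) (y := y)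
      (R := fun x' => R x' ∧ x' t = x t) (S := fun z' => z' t = z t),
    marg_eq_mul_of_factor hp (t := t) (m := m) (y := y) (R := R) (S := fun _ => True),
    marg_eq_mul_of_factor hp (t := t) (m := m) (y := y) (R := R) (S := fun z' => z' t = z t),
    marg_eq_mul_of_factor hp (t := t) (m := m) (y := y)
      (R := fun x' => R x' ∧ x' t = x t) (S := fun _ => True)]
  · ring
  all_goals
    intro t' m' x' y' z'
    have hk := key t' m' x' y'
    simp only [Prod.mk.injEq] at hk ⊢
    by_cases ht : t' = t
    · rw [ht] at hk ⊢
      tauto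
    · tauto

end SC
end
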